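/- arXiv:2007.11873 — 3 statements merged into one kernel-verified Lean document; each statement's English description precedes it below -/
import Mathlib

section
/- For every integer m ≥ 0, the alternating multiple zeta value ζ₋({1}^m, 2) := Σ_{0<m₁<⋯<m_{m+1}} (-1)^{m_{m+1}-1}/(m₁⋯m_m · m_{m+1}²) equals (-1)^m ζ(m+2) + (-1)^m · 2 (log 2)^{m+2}/(m+2)! + (-1)^{m+1} Σ_{k=0}^{m+2} Li_k(1/2) (log 2)^{m+2-k}/(m+2-k)!. -/
open scoped BigOperators

/-- Alternating multiple zeta value ζ₋(k₀,…,kₙ) = Σ_{0<m₁<⋯<m_{n+1}} (-1)^{m_{n+1}-1}/∏ mᵢ^{kᵢ},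
encoded with mᵢ = m i + 1. -/
noncomputable def zetaMinus {n : ℕ} (k : Fin (n + 1) → ℕ) : ℝ :=
  ∑' m : Fin (n + 1) → ℕ, if StrictMono m then
    (-1 : ℝ) ^ (m (Fin.last n)) * ∏ i, (1 : ℝ) / ((m i + 1 : ℝ) ^ (k i)) else 0

/-- Polylogarithm Li_k(z) = Σ_{m≥1} z^m/m^k. -/
noncomputable def Li (k : ℕ) (z : ℝ) : ℝ :=
  ∑' m : ℕ, z ^ (m + 1) / ((m + 1 : ℝ) ^ k)

/-- The truncated nested harmonic sum `∑_{m₁ < ⋯ < m_k < n} ∏ 1 / (mᵢ + 1)`. -/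
noncomputable def nestedHarmonic : ℕ → ℕ → ℝ
  | 0, _ => 1
  | m + 1, n => ∑ i ∈ Finset.range n, nestedHarmonic m i / (i + 1)

lemma nestedHarmonic_nonneg (m n : ℕ) : 0 ≤ nestedHarmonic m n := by
  induction m generalizing n with
  | zero => simp [nestedHarmonic]
  | succ m ih => exact Finset.sum_nonneg fun i _ => div_nonneg (ih i) (by positivity)

lemma sum_range_inv_sqrt_le (n : ℕ) :
    ∑ i ∈ Finset.range n, 1 / √(i + 1 : ℝ) ≤ 2 * √(n : ℝ) := by
  induction n with
  | zero => simp
  | succ n ih =>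
    rw [Finset.sum_range_succ]
    push_cast
    have hb : 0 < √(n + 1 : ℝ) := by positivity
    have h1 := Real.sq_sqrt (show (0 : ℝ) ≤ n by positivity)
    have h2 := Real.sq_sqrt (show (0 : ℝ) ≤ n + 1 by positivity)
    have h3 : 1 / √(n + 1 : ℝ) ≤ 2 * √(n + 1 : ℝ) - 2 * √(n : ℝ) := by
      rw [div_le_iff₀ hb]
      nlinarith [sq_nonneg (√(n + 1 : ℝ) - √(n : ℝ))]
    linarith

lemma nestedHarmonic_le (m n : ℕ) : nestedHarmonic m n ≤ 2 ^ m * √(n + 1 : ℝ) := by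
  induction m generalizing n with
  | zero => simp [nestedHarmonic]
  | succ m ih =>
    calc nestedHarmonic (m + 1) n
        ≤ ∑ i ∈ Finset.range n, 2 ^ m * (1 / √(i + 1 : ℝ)) := by
          refine Finset.sum_le_sum fun i _ => ?_
          rw [div_le_iff₀ (by positivity)]
          refine (ih i).trans (le_of_eq ?_)
          have h : √(i + 1 : ℝ) ≠ 0 := by positivity
          field_simp
          rw [Real.sq_sqrt (by positivity)]
      _ ≤ 2 ^ m * (2 * √(n : ℝ)) := by
          rw [← Finset.mul_sum]
          gcongr
          exact sum_range_inv_sqrt_le n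
      _ ≤ 2 ^ (m + 1) * √(n + 1 : ℝ) := by
          rw [pow_succ, mul_assoc]
          gcongr
          linarith

lemma summable_nestedHarmonic_div_sq (m : ℕ) :
    Summable fun n : ℕ => nestedHarmonic m n / (n + 1 : ℝ) ^ 2 := by
  have hs : Summable fun n : ℕ => 2 ^ m * (1 / ((n + 1 : ℕ) : ℝ) ^ (3 / 2 : ℝ)) :=
    ((summable_nat_add_iff 1).2
      (Real.summable_one_div_nat_rpow.2 (by norm_num : (1 : ℝ) < 3 / 2))).mul_left _
  refine hs.of_nonneg_of_le
    (fun n => div_nonneg (nestedHarmonic_nonneg m n) (by positivity)) fun n => ?_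
  have hn : (0 : ℝ) < n + 1 := by positivity
  rw [div_le_iff₀ (by positivity)]
  refine (nestedHarmonic_le m n).trans (le_of_eq ?_)
  push_cast
  rw [mul_assoc, Real.sqrt_eq_rpow, one_div_mul_eq_div, ← Real.rpow_natCast (n + 1 : ℝ) 2,
    ← Real.rpow_sub hn]
  norm_num

lemma strictMono_snoc_iff {m : ℕ} (f : Fin m → ℕ) (a : ℕ) :
    StrictMono (Fin.snoc f a : Fin (m + 1) → ℕ) ↔ StrictMono f ∧ ∀ i, f i < a := by
  constructor
  · intro h
    refine ⟨fun i j hij => ?_, fun i => ?_⟩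
    · simpa using h (Fin.castSucc_lt_castSucc_iff.2 hij)
    · simpa using h (Fin.castSucc_lt_last i)
  · rintro ⟨h, ha⟩ i j hij
    induction j using Fin.lastCases with
    | last =>
      induction i using Fin.lastCases with
      | last => exact absurd hij (lt_irrefl _)
      | cast i => simpa using ha i
    | cast j =>
      induction i using Fin.lastCases with
      | last => exact absurd hij (Fin.le_last _).not_gt
      | cast i => simpa using h (Fin.castSucc_lt_castSucc_iff.1 hij)

/-- The summand of the nested harmonic sum, extended by zero to all tuples. -/
noncomputable def nestedHarmonicTerm (m n : ℕ) (f : Fin m → ℕ) : ℝ :=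
  if StrictMono f ∧ ∀ i, f i < n then ∏ i, (1 : ℝ) / (f i + 1) else 0

lemma nestedHarmonicTerm_nonneg (m n : ℕ) (f : Fin m → ℕ) : 0 ≤ nestedHarmonicTerm m n f := by
  unfold nestedHarmonicTerm
  split_ifs
  · positivity
  · exact le_rfl

/-- Summation over tuples of length `m + 1`, grouped by the value of the last entry. -/
lemma hasSum_snoc {m : ℕ} {c : ℕ → ℝ}
    (hT : ∀ n, HasSum (nestedHarmonicTerm m n) (nestedHarmonic m n))
    (hc : Summable fun n => |c n| * nestedHarmonic m n) :
    HasSum (fun f : Fin (m + 1) → ℕ =>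
      c (f (Fin.last m)) * nestedHarmonicTerm m (f (Fin.last m)) (Fin.init f))
      (∑' n, c n * nestedHarmonic m n) := by
  rw [← (Fin.snocEquiv fun _ => ℕ).hasSum_iff]
  have key : Summable fun p : ℕ × (Fin m → ℕ) => c p.1 * nestedHarmonicTerm m p.1 p.2 := by
    refine Summable.of_norm ((summable_prod_of_nonneg fun _ => norm_nonneg _).2 ?_)
    have h : ∀ n, HasSum (fun f => ‖c n * nestedHarmonicTerm m n f‖)
        (|c n| * nestedHarmonic m n) := fun n => by
      simpa [abs_mul, abs_of_nonneg (nestedHarmonicTerm_nonneg m n _)] using (hT n).mul_left |c n|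
    exact ⟨fun n => (h n).summable, by simpa only [(h _).tsum_eq] using hc⟩
  have hs := key.hasSum
  rw [key.tsum_prod' fun n => ((hT n).mul_left (c n)).summable] at hs
  simp only [((hT _).mul_left _).tsum_eq] at hs
  convert hs using 2 with p
  simp [Fin.snocEquiv]

lemma nestedHarmonicTerm_succ (m n : ℕ) (f : Fin (m + 1) → ℕ) :
    nestedHarmonicTerm (m + 1) n f = (if f (Fin.last m) < n then 1 / (f (Fin.last m) + 1 : ℝ) else 0)
      * nestedHarmonicTerm m (f (Fin.last m)) (Fin.init f) := by
  have hf := strictMono_snoc_iff (Fin.init f) (f (Fin.last m))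
  rw [Fin.snoc_init_self] at hf
  unfold nestedHarmonicTerm
  rw [Fin.prod_univ_castSucc]
  by_cases h : StrictMono f
  · have hiff : (∀ i, f i < n) ↔ f (Fin.last m) < n :=
      ⟨fun h => h _, fun hl i => (h.monotone (Fin.le_last i)).trans_lt hl⟩
    rw [if_pos (hf.1 h)]
    simp only [h, hiff, true_and, Fin.init]
    split_ifs <;> ring
  · rw [if_neg fun hh => h hh.1, if_neg fun hh => h (hf.2 hh), mul_zero]

lemma hasSum_nestedHarmonicTerm (m n : ℕ) :
    HasSum (nestedHarmonicTerm m n) (nestedHarmonic m n) := by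
  induction m generalizing n with
  | zero =>
    convert hasSum_fintype (nestedHarmonicTerm 0 n)
    simp [nestedHarmonic, nestedHarmonicTerm, Subsingleton.strictMono]
  | succ m ih =>
    set c : ℕ → ℝ := fun i => if i < n then 1 / (i + 1 : ℝ) else 0 with hcdef
    have hz : ∀ i ∉ Finset.range n, c i = 0 := fun i hi => if_neg (by simpa using hi)
    have h := hasSum_snoc (c := c) ih
      (summable_of_ne_finset_zero (s := Finset.range n) fun i hi => by simp [hz i hi])
    rw [tsum_eq_sum (s := Finset.range n) fun i hi => by simp [hz i hi]] at h
    convert h using 1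
    · exact funext fun f => nestedHarmonicTerm_succ m n f
    · refine Finset.sum_congr rfl fun i hi => ?_
      simp only [hcdef, if_pos (Finset.mem_range.1 hi)]
      ring

/-- Termwise integration of the power series of `(-log (1 - x)) ^ m / m! / (1 - x)`. -/
lemma hasSum_nestedHarmonic_div_mul_pow_of {m : ℕ}
    (h : ∀ x : ℝ, |x| < 1 → HasSum (fun n => nestedHarmonic m n * x ^ n)
      ((-Real.log (1 - x)) ^ m / m.factorial / (1 - x))) {x : ℝ} (hx : |x| < 1) :
    HasSum (fun n : ℕ => nestedHarmonic m n / (n + 1) * x ^ (n + 1))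
      ((-Real.log (1 - x)) ^ (m + 1) / (m + 1).factorial) := by
  have hlt : ∀ t ∈ Set.uIcc 0 x, |t| ≤ |x| := fun t ht => by
    simpa using Set.abs_sub_left_of_mem_uIcc ht
  have hsub : ∀ t ∈ Set.uIoc 0 x, |t| ≤ |x| := fun t ht => hlt t (Set.uIoc_subset_uIcc ht)
  have hne : ∀ t ∈ Set.uIcc 0 x, 0 < 1 - t := fun t ht => by
    linarith [le_abs_self t, hlt t ht]
  have hsum := intervalIntegral.hasSum_integral_of_dominated_convergence
    (μ := MeasureTheory.volume) (a := 0) (b := x)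
    (F := fun n t => nestedHarmonic m n * t ^ n)
    (f := fun t => (-Real.log (1 - t)) ^ m / m.factorial / (1 - t))
    (fun n _ => nestedHarmonic m n * |x| ^ n)
    (fun n => by fun_prop)
    (fun n => .of_forall fun t ht => by
      rw [norm_mul, norm_pow, Real.norm_of_nonneg (nestedHarmonic_nonneg m n), Real.norm_eq_abs]
      exact mul_le_mul_of_nonneg_left (pow_le_pow_left₀ (abs_nonneg _) (hsub t ht) n)
        (nestedHarmonic_nonneg m n))
    (.of_forall fun t _ => (h |x| (by rwa [abs_abs])).summable)
    (by simp)
    (.of_forall fun t ht => h t ((hsub t ht).trans_lt hx))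
  have hderiv : ∀ t ∈ Set.uIcc 0 x, HasDerivAt
      (fun t => (-Real.log (1 - t)) ^ (m + 1) / (m + 1).factorial)
      ((-Real.log (1 - t)) ^ m / m.factorial / (1 - t)) t := fun t ht => by
    have hpos := hne t ht
    have hd := ((((hasDerivAt_id t).const_sub 1).log hpos.ne').neg.pow (m + 1)).div_const
      ((m + 1).factorial : ℝ)
    convert! hd using 1
    have := hpos.ne'
    simp only [id, Nat.factorial_succ, Pi.neg_apply]
    push_cast
    have : (m.factorial : ℝ) ≠ 0 := by positivity
    field_simp
  rw [intervalIntegral.integral_eq_sub_of_hasDerivAt hderiv] at hsum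
  · convert! hsum using 1
    · funext n
      simp [integral_pow]
      ring
    · simp
  · refine ContinuousOn.intervalIntegrable ?_
    refine ((ContinuousOn.pow (ContinuousOn.neg (ContinuousOn.log ?_ ?_)) m).div_const _).div ?_ ?_
    · fun_prop
    · exact fun t ht => (hne t ht).ne'
    · fun_prop
    · exact fun t ht => (hne t ht).ne'

/-- Generating function of the nested harmonic sums. -/
lemma hasSum_nestedHarmonic_mul_pow (m : ℕ) (x : ℝ) (hx : |x| < 1) :
    HasSum (fun n => nestedHarmonic m n * x ^ n)
      ((-Real.log (1 - x)) ^ m / m.factorial / (1 - x)) := by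
  induction m generalizing x with
  | zero => simpa [nestedHarmonic] using hasSum_geometric_of_abs_lt_one hx
  | succ m ih =>
    have hf := hasSum_nestedHarmonic_div_mul_pow_of ih hx
    have hg := hasSum_geometric_of_abs_lt_one hx
    have hc := hasSum_sum_range_mul_of_summable_norm hf.summable.norm hg.summable.norm
    rw [hf.tsum_eq, hg.tsum_eq, ← div_eq_mul_inv] at hc
    rw [← hasSum_nat_add_iff' 1]
    convert! hc using 1
    · funext n
      rw [nestedHarmonic, Finset.sum_mul]
      refine Finset.sum_congr rfl fun i hi => ?_
      have hi : i ≤ n := by simpa [Nat.lt_succ_iff] using hi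
      rw [mul_assoc, ← pow_add, show i + 1 + (n - i) = n + 1 by omega]
    · simp [nestedHarmonic]

lemma hasSum_nestedHarmonic_div_mul_pow (m : ℕ) {x : ℝ} (hx : |x| < 1) :
    HasSum (fun n : ℕ => nestedHarmonic m n / (n + 1) * x ^ (n + 1))
      ((-Real.log (1 - x)) ^ (m + 1) / (m + 1).factorial) :=
  hasSum_nestedHarmonic_div_mul_pow_of (hasSum_nestedHarmonic_mul_pow m) hx

open MeasureTheory in
/-- Integral representation of the alternating sum of weighted nested harmonic sums. -/
lemma tsum_nestedHarmonic_div_sq (m : ℕ) :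
    ∑' n : ℕ, (-1) ^ n / (n + 1 : ℝ) ^ 2 * nestedHarmonic m n =
      (-1) ^ m * ∫ t in Set.Ioo (0 : ℝ) 1,
        Real.log (1 + t) ^ (m + 1) / (m + 1).factorial / t := by
  have hpow : ∀ n : ℕ, ∫ t in Set.Ioo (0 : ℝ) 1, t ^ n = 1 / (n + 1 : ℝ) := fun n => by
    rw [← integral_Ioc_eq_integral_Ioo, ← intervalIntegral.integral_of_le zero_le_one, integral_pow]
    simp
  have h := hasSum_integral_of_summable_integral_norm
    (μ := volume.restrict (Set.Ioo (0 : ℝ) 1))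
    (F := fun (n : ℕ) t => nestedHarmonic m n / (n + 1) * (-1) ^ n * t ^ n)
    (fun n => by
      refine IntegrableOn.mono_set (t := Set.Icc 0 1) ?_ Set.Ioo_subset_Icc_self
      exact Continuous.integrableOn_Icc (by fun_prop))
    (by
      refine (summable_nestedHarmonic_div_sq m).congr fun n => ?_
      have : ∀ t ∈ Set.Ioo (0 : ℝ) 1, ‖nestedHarmonic m n / (n + 1) * (-1) ^ n * t ^ n‖ =
          nestedHarmonic m n / (n + 1) * t ^ n := fun t ht => by
        have h1 : (0 : ℝ) ≤ n + 1 := by positivity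
        simp [abs_of_nonneg (nestedHarmonic_nonneg m n), abs_of_nonneg h1, abs_of_pos ht.1]
      rw [setIntegral_congr_fun measurableSet_Ioo this, integral_const_mul, hpow]
      field_simp)
  simp only [integral_const_mul, hpow] at h
  rw [← integral_const_mul]
  convert h.tsum_eq using 1
  · refine tsum_congr fun n => ?_
    field_simp
  · refine setIntegral_congr_fun measurableSet_Ioo fun t ht => ?_
    have hs := (hasSum_nestedHarmonic_div_mul_pow m (x := -t)
      (by rw [abs_neg, abs_of_pos ht.1]; exact ht.2)).mul_left (-1 / t)
    refine Eq.trans ?_ (hs.congr_fun fun n => ?_).tsum_eq.symm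
    · rw [sub_neg_eq_add, neg_pow]
      ring
    · have := ht.1.ne'
      rw [neg_pow t]
      field_simp
      ring

/-- An antiderivative of `u ^ M / M! * exp (-c * u)`. -/
lemma hasDerivAt_pow_mul_exp (M : ℕ) {c : ℝ} (hc : c ≠ 0) (u : ℝ) :
    HasDerivAt (fun u => -(Real.exp (-c * u) *
        ∑ j ∈ Finset.range (M + 1), u ^ j / j.factorial / c ^ (M + 1 - j)))
      (u ^ M / M.factorial * Real.exp (-c * u)) u := by
  have he : HasDerivAt (fun u => Real.exp (-c * u)) (Real.exp (-c * u) * -c) u := by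
    simpa using ((hasDerivAt_id u).const_mul (-c)).exp
  induction M with
  | zero =>
    convert! (he.mul_const (1 / c)).neg using 1
    · funext v
      simp
    · field_simp
      simp
  | succ M ih =>
    have hp : HasDerivAt (fun u : ℝ => u ^ (M + 1) / (M + 1).factorial) (u ^ M / M.factorial) u := by
      convert! (hasDerivAt_pow (M + 1) u).div_const ((M + 1).factorial : ℝ) using 1
      rw [Nat.factorial_succ]
      push_cast
      field_simp
    convert! (ih.div_const c).sub ((he.mul hp).div_const c) using 1
    · funext v
      simp only [Pi.sub_apply, Pi.mul_apply]
      rw [Finset.sum_range_succ]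
      have : ∑ j ∈ Finset.range (M + 1), v ^ j / j.factorial / c ^ (M + 1 + 1 - j) =
          (∑ j ∈ Finset.range (M + 1), v ^ j / j.factorial / c ^ (M + 1 - j)) / c := by
        rw [Finset.sum_div]
        refine Finset.sum_congr rfl fun j hj => ?_
        have hj := Finset.mem_range.1 hj
        rw [show M + 1 + 1 - j = M + 1 - j + 1 by omega, pow_succ]
        field_simp
      rw [this, show M + 1 + 1 - (M + 1) = 1 by omega]
      ring
    · field_simp
      ring

lemma integral_pow_mul_exp (M : ℕ) {c : ℝ} (hc : c ≠ 0) {L : ℝ} (hL : 0 ≤ L) :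
    ∫ u in Set.Ioo 0 L, u ^ M / M.factorial * Real.exp (-c * u) =
      1 / c ^ (M + 1) -
        ∑ j ∈ Finset.range (M + 1), L ^ j / j.factorial * (Real.exp (-c * L) / c ^ (M + 1 - j)) := by
  rw [← MeasureTheory.integral_Ioc_eq_integral_Ioo, ← intervalIntegral.integral_of_le hL,
    intervalIntegral.integral_eq_sub_of_hasDerivAt (fun u _ => hasDerivAt_pow_mul_exp M hc u)
      (Continuous.intervalIntegrable (by fun_prop) _ _)]
  rw [Finset.sum_range_succ' (fun j => (0 : ℝ) ^ j / j.factorial / c ^ (M + 1 - j)),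
    Finset.mul_sum]
  simp only [mul_zero, Real.exp_zero, one_mul, ne_eq, Nat.add_eq_zero_iff, one_ne_zero, and_false,
    not_false_eq_true, zero_pow, zero_div, Finset.sum_const_zero, pow_zero, Nat.factorial_zero,
    Nat.cast_one, div_one, Nat.sub_zero, zero_add]
  rw [sub_neg_eq_add, neg_add_eq_sub]
  congr 1
  exact Finset.sum_congr rfl fun j _ => by ring

lemma summable_Li_half (k : ℕ) : Summable fun n : ℕ => (1 / 2 : ℝ) ^ (n + 1) / (n + 1 : ℝ) ^ k := by
  refine ((summable_nat_add_iff 1).2 summable_geometric_two).of_nonneg_of_le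
    (fun n => by positivity) fun n => ?_
  exact div_le_self (by positivity) (one_le_pow₀ (by linarith [n.cast_nonneg (α := ℝ)]))

lemma Li_zero_half : Li 0 (1 / 2) = 1 := by
  have h := (hasSum_nat_add_iff' 1).2 hasSum_geometric_two
  simp only [Li, pow_zero, div_one]
  rw [h.tsum_eq]
  norm_num

/-- The incomplete Gamma integrals sum to a combination of a zeta value and polylogarithms. -/
lemma hasSum_integral_pow_mul_exp {M : ℕ} (hM : 1 ≤ M) :
    HasSum (fun n : ℕ => ∫ u in Set.Ioo 0 (Real.log 2),
        u ^ M / M.factorial * Real.exp (-((n : ℝ) + 1) * u))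
      (∑' n : ℕ, 1 / (n + 1 : ℝ) ^ (M + 1) -
        ∑ j ∈ Finset.range (M + 1), Real.log 2 ^ j / j.factorial * Li (M + 1 - j) (1 / 2)) := by
  have hz : Summable fun n : ℕ => 1 / (n + 1 : ℝ) ^ (M + 1) := by
    simpa using (summable_nat_add_iff 1).2
      (Real.summable_one_div_nat_pow.2 (show 1 < M + 1 by omega))
  refine (hz.hasSum.sub (hasSum_sum fun j _ =>
    (summable_Li_half (M + 1 - j)).hasSum.mul_left _)).congr_fun fun n => ?_
  rw [integral_pow_mul_exp M (by positivity) (Real.log_nonneg one_le_two)]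
  have he : Real.exp (-((n : ℝ) + 1) * Real.log 2) = (1 / 2) ^ (n + 1) := by
    rw [show -((n : ℝ) + 1) * Real.log 2 = ((n + 1 : ℕ) : ℝ) * -Real.log 2 by push_cast; ring,
      Real.exp_nat_mul, Real.exp_neg, Real.exp_log two_pos, one_div]
  rw [he]

open MeasureTheory in
lemma integral_log_one_add_pow_div {M : ℕ} (hM : 1 ≤ M) :
    ∫ t in Set.Ioo (0 : ℝ) 1, Real.log (1 + t) ^ M / M.factorial / t =
      Real.log 2 ^ (M + 1) / (M + 1).factorial + (∑' n : ℕ, 1 / (n + 1 : ℝ) ^ (M + 1) -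
        ∑ j ∈ Finset.range (M + 1), Real.log 2 ^ j / j.factorial * Li (M + 1 - j) (1 / 2)) := by
  have himage : (fun u => Real.exp u - 1) '' Set.Ioo 0 (Real.log 2) = Set.Ioo 0 1 := by
    ext t
    constructor
    · rintro ⟨u, hu, rfl⟩
      have h1 := Real.one_lt_exp_iff.2 hu.1
      have h2 := (Real.lt_log_iff_exp_lt two_pos).1 hu.2
      constructor <;> simp only <;> linarith
    · intro ht
      have hpos : 0 < 1 + t := by linarith [ht.1]
      refine ⟨Real.log (1 + t), ⟨Real.log_pos (by linarith [ht.1]),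
        Real.log_lt_log hpos (by linarith [ht.2])⟩, ?_⟩
      simp [Real.exp_log hpos]
  rw [← himage, integral_image_eq_integral_abs_deriv_smul measurableSet_Ioo
    (fun u _ => ((Real.hasDerivAt_exp u).sub_const 1).hasDerivWithinAt)
    (fun u _ v _ h => Real.exp_injective (sub_left_injective h))]
  have hint : ∀ n : ℕ, IntegrableOn (fun u : ℝ => u ^ M / M.factorial * Real.exp (-(n : ℝ) * u))
      (Set.Ioo 0 (Real.log 2)) := fun n =>
    IntegrableOn.mono_set (Continuous.integrableOn_Icc (by fun_prop)) Set.Ioo_subset_Icc_self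
  have hshift := hasSum_integral_pow_mul_exp hM
  have hsum : Summable fun n : ℕ => ∫ u in Set.Ioo 0 (Real.log 2),
      u ^ M / M.factorial * Real.exp (-(n : ℝ) * u) := by
    rw [← summable_nat_add_iff 1]
    simpa using hshift.summable
  have h := hasSum_integral_of_summable_integral_norm
    (μ := volume.restrict (Set.Ioo 0 (Real.log 2))) hint
    (hsum.congr fun n => setIntegral_congr_fun measurableSet_Ioo fun u hu =>
      (Real.norm_of_nonneg (by have := hu.1; positivity)).symm)
  have hzero : ∫ u in Set.Ioo 0 (Real.log 2), u ^ M / (M.factorial : ℝ) =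
      Real.log 2 ^ (M + 1) / (M + 1).factorial := by
    rw [← integral_Ioc_eq_integral_Ioo,
      ← intervalIntegral.integral_of_le (Real.log_nonneg one_le_two),
      intervalIntegral.integral_div, integral_pow, Nat.factorial_succ]
    push_cast
    field_simp
    simp
  rw [← hzero, ← hshift.tsum_eq]
  have hsplit := hsum.tsum_eq_zero_add
  simp only [Nat.cast_zero, neg_zero, zero_mul, Real.exp_zero, mul_one, Nat.cast_add,
    Nat.cast_one] at hsplit
  rw [← hsplit, h.tsum_eq]
  refine setIntegral_congr_fun measurableSet_Ioo fun u hu => ?_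
  have hlt : Real.exp (-u) < 1 := Real.exp_lt_one_iff.2 (neg_lt_zero.2 hu.1)
  have hg := (hasSum_geometric_of_lt_one (Real.exp_pos (-u)).le hlt).mul_left
    (u ^ M / (M.factorial : ℝ))
  refine Eq.trans ?_ (hg.congr_fun fun n => ?_).tsum_eq.symm
  · have h1 : Real.exp u - 1 ≠ 0 := (sub_pos.2 (Real.one_lt_exp_iff.2 hu.1)).ne'
    have h2 : (1 - Real.exp (-u))⁻¹ = Real.exp u / (Real.exp u - 1) := by
      rw [Real.exp_neg, inv_eq_one_div, div_eq_div_iff _ h1]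
      · field_simp
      · rw [← Real.exp_neg]
        exact (sub_pos.2 hlt).ne'
    simp only [smul_eq_mul, add_sub_cancel, Real.log_exp, abs_of_pos (Real.exp_pos u), h2]
    ring
  · rw [← Real.exp_nat_mul]
    ring_nf

lemma zetaMinus_eq_tsum (m : ℕ) :
    zetaMinus (fun i : Fin (m + 1) => if i = Fin.last m then 2 else 1) =
      ∑' n : ℕ, (-1) ^ n / (n + 1 : ℝ) ^ 2 * nestedHarmonic m n := by
  rw [← (hasSum_snoc (c := fun n : ℕ => (-1) ^ n / (n + 1 : ℝ) ^ 2)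
    (hasSum_nestedHarmonicTerm m) ?_).tsum_eq]
  · refine tsum_congr fun f => ?_
    have hf := strictMono_snoc_iff (Fin.init f) (f (Fin.last m))
    rw [Fin.snoc_init_self] at hf
    simp only [nestedHarmonicTerm, ← hf]
    split_ifs
    · simp only [Fin.prod_univ_castSucc, Fin.castSucc_ne_last, if_false, if_true, pow_one, Fin.init]
      ring
    · ring
  · refine (summable_nestedHarmonic_div_sq m).congr fun n => ?_
    have : (0 : ℝ) ≤ n + 1 := by positivity
    simp [abs_div, abs_of_nonneg this]
    ring

theorem stmt0 (m : ℕ) :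
    (zetaMinus (fun i : Fin (m + 1) => if i = Fin.last m then 2 else 1) : ℂ)
      = (-1) ^ m * riemannZeta (m + 2)
        + (-1) ^ m * 2 * ((Real.log 2) ^ (m + 2) / (Nat.factorial (m + 2)) : ℝ)
        + (-1) ^ (m + 1) * ((∑ k ∈ Finset.range (m + 3),
            Li k (1/2) * (Real.log 2) ^ (m + 2 - k) / (Nat.factorial (m + 2 - k)) : ℝ)) := by
  have hzeta : riemannZeta (m + 2) = ((∑' n : ℕ, 1 / (n + 1 : ℝ) ^ (m + 2) : ℝ) : ℂ) := by
    have h := zeta_eq_tsum_one_div_nat_add_one_cpow (s := (m + 2 : ℕ))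
      (by rw [Complex.natCast_re]; norm_cast; omega)
    simp only [Complex.cpow_natCast] at h
    push_cast at h ⊢
    exact h
  have hsum : ∑ k ∈ Finset.range (m + 3),
      Li k (1/2) * (Real.log 2) ^ (m + 2 - k) / (Nat.factorial (m + 2 - k)) =
      ∑ j ∈ Finset.range (m + 2), Real.log 2 ^ j / j.factorial * Li (m + 2 - j) (1 / 2) +
        Real.log 2 ^ (m + 2) / (m + 2).factorial := by
    rw [← Finset.sum_range_reflect, Finset.sum_range_succ]
    congr 1
    · refine Finset.sum_congr rfl fun j hj => ?_
      have hj := Finset.mem_range.1 hj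
      rw [show m + 3 - 1 - j = m + 2 - j by omega, show m + 2 - (m + 2 - j) = j by omega]
      ring
    · rw [show m + 3 - 1 - (m + 2) = 0 by omega, Li_zero_half, Nat.sub_zero, one_mul]
  rw [hzeta, hsum, zetaMinus_eq_tsum, tsum_nestedHarmonic_div_sq,
    integral_log_one_add_pow_div (Nat.le_add_left 1 m)]
  generalize ∑' n : ℕ, 1 / (n + 1 : ℝ) ^ (m + 2) = Z
  generalize ∑ j ∈ Finset.range (m + 2), Real.log 2 ^ j / j.factorial * Li (m + 2 - j) (1 / 2) = S
  generalize Real.log 2 ^ (m + 2) / ((m + 2).factorial : ℝ) = P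
  push_cast
  ring
end

section
/- ζ₋(1,3) := Σ_{0<m₁<m₂} (-1)^{m₂-1}/(m₁ m₂³) equals -2 Li₄(1/2) - (log 2)⁴/12 + (15/8) ζ(4) - (7/4) ζ(3) log 2 + (1/2) ζ(2) (log 2)². -/
open scoped BigOperators

/-- The weighted polylogarithm `∑ a m * z ^ (m + 1) / (m + 1) ^ k`. -/
noncomputable def weightedPolylog (a : ℕ → ℝ) (k : ℕ) (z : ℝ) : ℝ :=
  ∑' m : ℕ, a m * z ^ (m + 1) / ((m + 1 : ℝ) ^ k)

/-- The harmonic numbers as real numbers. -/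
noncomputable def realHarmonic (m : ℕ) : ℝ := (harmonic m : ℚ)

lemma realHarmonic_zero : realHarmonic 0 = 0 := by simp [realHarmonic]

lemma realHarmonic_succ (m : ℕ) : realHarmonic (m + 1) = realHarmonic m + 1 / (m + 1 : ℝ) := by
  simp [realHarmonic, harmonic_succ]

lemma realHarmonic_eq_sum (m : ℕ) :
    realHarmonic m = ∑ i ∈ Finset.range m, 1 / (i + 1 : ℝ) := by
  simp [realHarmonic, harmonic]

lemma realHarmonic_nonneg (m : ℕ) : 0 ≤ realHarmonic m := by
  rw [realHarmonic_eq_sum]; positivity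

lemma abs_realHarmonic_le (m : ℕ) : |realHarmonic m| ≤ m + 1 := by
  rw [abs_of_nonneg (realHarmonic_nonneg m)]
  induction m with
  | zero => simp [realHarmonic_zero]
  | succ n ih =>
    have h : 1 / (n + 1 : ℝ) ≤ 1 := by
      rw [div_le_one (by positivity)]; linarith [n.cast_nonneg (α := ℝ)]
    rw [realHarmonic_succ]; push_cast; linarith

lemma Li_eq_weightedPolylog (k : ℕ) : Li k = weightedPolylog (fun _ => 1) k := by
  funext z; simp [Li, weightedPolylog]

lemma summable_one_div_succ_pow {k : ℕ} (hk : 2 ≤ k) :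
    Summable fun m : ℕ => 1 / ((m + 1 : ℝ) ^ k) := by
  have := (summable_nat_add_iff 1).mpr (Real.summable_one_div_nat_pow.mpr (show 1 < k by omega))
  simpa using this

lemma summable_succ_mul_geometric {r : ℝ} (h0 : 0 ≤ r) (h1 : r < 1) :
    Summable fun m : ℕ => (m + 1 : ℝ) * r ^ m := by
  have hr : ‖r‖ < 1 := by rwa [Real.norm_of_nonneg h0]
  have := (summable_pow_mul_geometric_of_norm_lt_one 1 hr).add
    (summable_geometric_of_norm_lt_one hr)
  refine this.congr fun m => ?_
  ring

lemma weightedPolylog_zero_right (a : ℕ → ℝ) (k : ℕ) : weightedPolylog a k 0 = 0 := by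
  simp [weightedPolylog]

lemma mul_tsum_eq_weightedPolylog (a : ℕ → ℝ) (k : ℕ) (z : ℝ) :
    z * ∑' m : ℕ, a m * z ^ m / ((m + 1 : ℝ) ^ k) = weightedPolylog a k z := by
  rw [weightedPolylog, ← tsum_mul_left]
  exact tsum_congr fun m => by ring

lemma hasDerivAt_weightedPolylog_tsum {a : ℕ → ℝ} (ha : ∀ m : ℕ, |a m| ≤ m + 1) (k : ℕ) {z : ℝ}
    (hz : |z| < 1) :
    HasDerivAt (weightedPolylog a (k + 1)) (∑' m : ℕ, a m * z ^ m / ((m + 1 : ℝ) ^ k)) z := by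
  obtain ⟨r, hzr, hr⟩ := exists_between hz
  have hr0 : 0 < r := (abs_nonneg z).trans_lt hzr
  refine hasDerivAt_tsum_of_isPreconnected (t := Metric.ball 0 r) (y₀ := 0)
    (u := fun m : ℕ => (m + 1 : ℝ) * r ^ m)
    (g := fun (m : ℕ) z => a m * z ^ (m + 1) / ((m + 1 : ℝ) ^ (k + 1)))
    (g' := fun (m : ℕ) z => a m * z ^ m / ((m + 1 : ℝ) ^ k))
    (summable_succ_mul_geometric hr0.le hr) Metric.isOpen_ball
    (convex_ball _ _).isPreconnected ?_ ?_ (by simpa using hr0) (by simp) (by simpa using hzr)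
  · intro m y _
    have h := ((hasDerivAt_pow (m + 1) y).const_mul (a m)).div_const ((m + 1 : ℝ) ^ (k + 1))
    refine h.congr_deriv ?_
    have : (m + 1 : ℝ) ≠ 0 := by positivity
    push_cast
    field_simp
    ring
  · intro m y hy
    have hy' : |y| ≤ r := by simpa using (mem_ball_zero_iff.mp hy).le
    have hk : (1 : ℝ) ≤ (m + 1 : ℝ) ^ k := one_le_pow₀ (by linarith [m.cast_nonneg (α := ℝ)])
    rw [Real.norm_eq_abs, abs_div, abs_mul, abs_pow,
      abs_of_pos (by positivity : 0 < (m + 1 : ℝ) ^ k)]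
    refine (div_le_self (by positivity) hk).trans ?_
    gcongr
    exact ha m

lemma hasDerivAt_weightedPolylog {a : ℕ → ℝ} (ha : ∀ m : ℕ, |a m| ≤ m + 1) (k : ℕ) {z : ℝ}
    (hz : |z| < 1) (hz0 : z ≠ 0) :
    HasDerivAt (weightedPolylog a (k + 1)) (weightedPolylog a k z / z) z := by
  refine (hasDerivAt_weightedPolylog_tsum ha k hz).congr_deriv ?_
  rw [← mul_tsum_eq_weightedPolylog, mul_div_cancel_left₀ _ hz0]

lemma continuousOn_weightedPolylog {a : ℕ → ℝ} {k : ℕ}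
    (h : Summable fun m : ℕ => |a m| / (m + 1 : ℝ) ^ k) :
    ContinuousOn (weightedPolylog a k) (Set.Icc (-1) 1) := by
  refine continuousOn_tsum (fun m => by fun_prop) h fun m x hx => ?_
  rw [Real.norm_eq_abs, abs_div, abs_mul, abs_pow,
    abs_of_pos (by positivity : 0 < (m + 1 : ℝ) ^ k)]
  have : |x| ^ (m + 1) ≤ 1 := pow_le_one₀ (abs_nonneg x) (abs_le.mpr hx)
  gcongr
  exact mul_le_of_le_one_right (abs_nonneg _) this

lemma continuousOn_Li {k : ℕ} (hk : 2 ≤ k) : ContinuousOn (Li k) (Set.Icc (-1) 1) := by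
  rw [Li_eq_weightedPolylog]
  exact continuousOn_weightedPolylog (by simpa using summable_one_div_succ_pow hk)

lemma hasDerivAt_Li (k : ℕ) {z : ℝ} (hz : |z| < 1) (hz0 : z ≠ 0) :
    HasDerivAt (Li (k + 1)) (Li k z / z) z := by
  simp only [Li_eq_weightedPolylog]
  exact hasDerivAt_weightedPolylog (fun m => by simp) k hz hz0

lemma Li_one {z : ℝ} (hz : |z| < 1) : Li 1 z = -Real.log (1 - z) := by
  simpa [Li] using (Real.hasSum_pow_div_log_of_abs_lt_one hz).tsum_eq

lemma Li_zero_right (k : ℕ) : Li k 0 = 0 := by simp [Li]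

lemma riemannZeta_eq_Li {k : ℕ} (hk : 2 ≤ k) : riemannZeta k = (Li k 1 : ℝ) := by
  rw [zeta_nat_eq_tsum_of_gt_one (by omega), Summable.tsum_eq_zero_add]
  · have : k ≠ 0 := by omega
    simp [Li, this, Complex.ofReal_tsum]
  · simpa using Complex.ofRealCLM.summable
      (Real.summable_one_div_nat_pow.mpr (show 1 < k by omega))

lemma Li_neg_one {k : ℕ} (hk : 2 ≤ k) : Li k (-1) = (2 / 2 ^ k - 1) * Li k 1 := by
  have hs := summable_one_div_succ_pow hk
  have he : Summable fun m : ℕ => 1 / ((2 * m + 1 : ℝ) ^ k) := by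
    have := hs.comp_injective (i := fun m : ℕ => 2 * m) fun a b h => by simpa using h
    simpa [Function.comp_def] using this
  have ho : Summable fun m : ℕ => 1 / ((2 * m + 1 + 1 : ℝ) ^ k) := by
    have := hs.comp_injective (i := fun m : ℕ => 2 * m + 1) fun a b h => by simpa using h
    simpa [Function.comp_def] using this
  have hodd : ∑' m : ℕ, 1 / ((2 * m + 1 + 1 : ℝ) ^ k) = Li k 1 / 2 ^ k := by
    rw [Li, ← tsum_div_const]
    refine tsum_congr fun m => ?_
    rw [show (2 * m + 1 + 1 : ℝ) = (m + 1) * 2 by ring, mul_pow, one_pow, div_div]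
  have h1 := tsum_even_add_odd (f := fun m : ℕ => 1 / ((m + 1 : ℝ) ^ k))
    (by simpa using he) (by simpa using ho)
  have h2 := tsum_even_add_odd (f := fun m : ℕ => (-1 : ℝ) ^ (m + 1) / ((m + 1 : ℝ) ^ k))
    (by simpa [pow_succ, pow_mul, neg_div] using he.neg)
    (by simpa [pow_succ, pow_mul] using ho)
  have e1 : Li k 1 = ∑' m : ℕ, 1 / ((m + 1 : ℝ) ^ k) := by simp [Li]
  have e2 : Li k (-1) = -(∑' m : ℕ, 1 / ((2 * m + 1 : ℝ) ^ k)) + Li k 1 / 2 ^ k := by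
    rw [Li, ← h2, ← hodd, ← tsum_neg]
    congr 1 <;> exact tsum_congr fun m => by simp [pow_succ, pow_mul, neg_div]
  push_cast at h1
  rw [hodd, ← e1] at h1
  rw [e2]
  linear_combination -h1

/-- A function with vanishing derivative takes the same value at both ends of an interval. -/
lemma eq_of_hasDerivAt_zero {f : ℝ → ℝ} {a b : ℝ} (hab : a ≤ b)
    (hc : ContinuousOn f (Set.Icc a b)) (hd : ∀ x ∈ Set.Ioo a b, HasDerivAt f 0 x) :
    f b = f a := by
  rcases hab.eq_or_lt with rfl | h
  · rfl
  obtain ⟨c, -, hcs⟩ := exists_hasDerivAt_eq_slope f (fun _ => 0) h hc hd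
  rw [eq_comm, div_eq_zero_iff] at hcs
  rcases hcs with hcs | hcs <;> linarith

lemma one_sub_mul_tsum_realHarmonic {z : ℝ} (hz : |z| < 1) :
    (1 - z) * ∑' m : ℕ, realHarmonic m * z ^ m = -Real.log (1 - z) := by
  have hs : Summable fun m : ℕ => realHarmonic m * z ^ m := by
    refine Summable.of_norm_bounded (summable_succ_mul_geometric (abs_nonneg z) hz) fun m => ?_
    rw [Real.norm_eq_abs, abs_mul, abs_pow]
    gcongr
    exact abs_realHarmonic_le m
  have hlog := Real.hasSum_pow_div_log_of_abs_lt_one hz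
  have h : ∑' m : ℕ, realHarmonic m * z ^ m =
      z * (∑' m : ℕ, realHarmonic m * z ^ m) + -Real.log (1 - z) := by
    conv_lhs => rw [hs.tsum_eq_zero_add]
    rw [← tsum_mul_left, ← hlog.tsum_eq, ← (hs.mul_left z).tsum_add hlog.summable]
    simp only [realHarmonic_zero, zero_mul, zero_add]
    refine tsum_congr fun m => ?_
    rw [realHarmonic_succ]
    ring
  linarith

section Interval

variable {y : ℝ}

lemma hasDerivAt_log_one_add (hy : 0 < y) :
    HasDerivAt (fun t => Real.log (1 + t)) (1 / (1 + y)) y := by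
  simpa using ((hasDerivAt_id y).const_add 1).log (by simp; positivity)

lemma hasDerivAt_weightedPolylog_neg {a : ℕ → ℝ} (ha : ∀ m : ℕ, |a m| ≤ m + 1) (k : ℕ)
    (hy : y ∈ Set.Ioo 0 1) :
    HasDerivAt (fun t => weightedPolylog a (k + 1) (-t)) (weightedPolylog a k (-y) / y) y := by
  have h := hasDerivAt_weightedPolylog ha k (z := -y)
    (by rw [abs_neg, abs_of_pos hy.1]; exact hy.2) (neg_ne_zero.mpr hy.1.ne')
  refine (h.comp y (hasDerivAt_neg y)).congr_deriv ?_
  have := hy.1.ne'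
  field_simp

lemma hasDerivAt_Li_neg (k : ℕ) (hy : y ∈ Set.Ioo 0 1) :
    HasDerivAt (fun t => Li (k + 1) (-t)) (Li k (-y) / y) y := by
  simp only [Li_eq_weightedPolylog]
  exact hasDerivAt_weightedPolylog_neg (fun m => by simp) k hy

lemma hasDerivAt_Li_div_one_add (k : ℕ) (hy : 0 < y) :
    HasDerivAt (fun t => Li (k + 1) (t / (1 + t)))
      (Li k (y / (1 + y)) * (1 / y - 1 / (1 + y))) y := by
  have h1 : 0 < 1 + y := by positivity
  have h := hasDerivAt_Li k (z := y / (1 + y))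
    (by rw [abs_of_pos (by positivity), div_lt_one h1]; linarith) (by positivity)
  have hd : HasDerivAt (fun t => t / (1 + t)) ((1 * (1 + y) - y * 1) / (1 + y) ^ 2) y :=
    (hasDerivAt_id y).div ((hasDerivAt_id y).const_add 1) h1.ne'
  refine (h.comp y hd).congr_deriv ?_
  field_simp

lemma hasDerivAt_Li_inv_one_add (k : ℕ) (hy : 0 < y) :
    HasDerivAt (fun t => Li (k + 1) (1 / (1 + t))) (-Li k (1 / (1 + y)) / (1 + y)) y := by
  have h1 : 0 < 1 + y := by positivity
  have h := hasDerivAt_Li k (z := 1 / (1 + y))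
    (by rw [abs_of_pos (by positivity), div_lt_one h1]; linarith) (by positivity)
  have hd : HasDerivAt (fun t => 1 / (1 + t)) ((0 * (1 + y) - 1 * 1) / (1 + y) ^ 2) y :=
    (hasDerivAt_const y (1 : ℝ)).div ((hasDerivAt_id y).const_add 1) h1.ne'
  refine (h.comp y hd).congr_deriv ?_
  field_simp
  ring

lemma Li_one_neg (hy : y ∈ Set.Ioo 0 1) : Li 1 (-y) = -Real.log (1 + y) := by
  rw [Li_one (by rw [abs_neg, abs_of_pos hy.1]; exact hy.2), sub_neg_eq_add]

lemma Li_one_div_one_add (hy : 0 < y) : Li 1 (y / (1 + y)) = Real.log (1 + y) := by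
  have h1 : 0 < 1 + y := by positivity
  rw [Li_one (by rw [abs_of_pos (by positivity), div_lt_one h1]; linarith),
    show 1 - y / (1 + y) = (1 + y)⁻¹ by field_simp; ring, Real.log_inv, neg_neg]

lemma Li_one_inv_one_add (hy : 0 < y) :
    Li 1 (1 / (1 + y)) = Real.log (1 + y) - Real.log y := by
  have h1 : 0 < 1 + y := by positivity
  rw [Li_one (by rw [abs_of_pos (by positivity), div_lt_one h1]; linarith),
    show 1 - 1 / (1 + y) = y / (1 + y) by field_simp; ring, Real.log_div hy.ne' h1.ne']
  ring

lemma continuousOn_log_one_add :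
    ContinuousOn (fun t => Real.log (1 + t)) (Set.Icc 0 1) :=
  ContinuousOn.log (by fun_prop) fun t ht => by linarith [ht.1]

lemma continuousOn_Li_neg {k : ℕ} (hk : 2 ≤ k) :
    ContinuousOn (fun t => Li k (-t)) (Set.Icc 0 1) :=
  (continuousOn_Li hk).comp (by fun_prop) fun t ht => ⟨by linarith [ht.2], by linarith [ht.1]⟩

lemma continuousOn_Li_div_one_add {k : ℕ} (hk : 2 ≤ k) :
    ContinuousOn (fun t => Li k (t / (1 + t))) (Set.Icc 0 1) := by
  refine (continuousOn_Li hk).comp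
    (ContinuousOn.div (by fun_prop) (by fun_prop) fun t ht => by linarith [ht.1]) fun t ht => ?_
  have h1 : 0 < 1 + t := by linarith [ht.1]
  exact ⟨by linarith [div_nonneg ht.1 h1.le], by rw [div_le_one h1]; linarith⟩

lemma continuousOn_Li_inv_one_add {k : ℕ} (hk : 2 ≤ k) :
    ContinuousOn (fun t => Li k (1 / (1 + t))) (Set.Icc 0 1) := by
  refine (continuousOn_Li hk).comp
    (ContinuousOn.div (by fun_prop) (by fun_prop) fun t ht => by linarith [ht.1]) fun t ht => ?_
  have h1 : 0 < 1 + t := by linarith [ht.1]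
  exact ⟨by linarith [div_nonneg zero_le_one h1.le], by rw [div_le_one h1]; linarith [ht.1]⟩

lemma continuousOn_log_mul_log_one_add :
    ContinuousOn (fun t => Real.log t * Real.log (1 + t)) (Set.Icc 0 1) := by
  intro t ht
  rcases ht.1.eq_or_lt with rfl | h
  · have hlim : Filter.Tendsto (fun t => |t * Real.log t|) (nhdsWithin 0 (Set.Icc 0 1))
        (nhds 0) := by
      have : ContinuousAt (fun t => |t * Real.log t|) 0 :=
        Real.continuous_mul_log.abs.continuousAt
      simpa using this.tendsto.mono_left nhdsWithin_le_nhds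
    rw [ContinuousWithinAt, Real.log_zero, zero_mul]
    refine squeeze_zero_norm' ?_ hlim
    filter_upwards [self_mem_nhdsWithin] with s hs
    have h0 : 0 ≤ Real.log (1 + s) := Real.log_nonneg (by linarith [hs.1])
    have h1 : Real.log (1 + s) ≤ s := by
      linarith [Real.log_le_sub_one_of_pos (show 0 < 1 + s by linarith [hs.1])]
    rw [Real.norm_eq_abs, abs_mul, abs_mul, mul_comm, abs_of_nonneg h0, abs_of_nonneg hs.1]
    gcongr
  · exact ((Real.continuousAt_log h.ne').mul
      (Real.continuousAt_log (x := 1 + t) (by linarith) |>.comp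
        (f := fun t => 1 + t) (by fun_prop))).continuousWithinAt

/-- Landen's identity for the dilogarithm. -/
lemma Li_two_landen (hy : y ∈ Set.Icc 0 1) :
    Li 2 (y / (1 + y)) = -Li 2 (-y) - Real.log (1 + y) ^ 2 / 2 := by
  have hsub : Set.Icc 0 y ⊆ Set.Icc 0 1 := Set.Icc_subset_Icc_right hy.2
  have h := eq_of_hasDerivAt_zero
    (f := fun t => Li 2 (t / (1 + t)) + Li 2 (-t) + Real.log (1 + t) ^ 2 / 2) hy.1
    (((continuousOn_Li_div_one_add le_rfl).add (continuousOn_Li_neg le_rfl)).add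
      ((continuousOn_log_one_add.pow 2).div_const 2) |>.mono hsub) fun t ht => by
      have ht' : t ∈ Set.Ioo 0 1 := ⟨ht.1, ht.2.trans_le hy.2⟩
      have h1 : 0 < 1 + t := by linarith [ht.1]
      have h0 := ht.1
      refine (((hasDerivAt_Li_div_one_add 1 ht.1).add (hasDerivAt_Li_neg 1 ht')).add
        (((hasDerivAt_log_one_add ht.1).pow 2).div_const 2)).congr_deriv ?_
      rw [Li_one_div_one_add ht.1, Li_one_neg ht']
      field_simp
      ring
  simp [Li_zero_right] at h
  linarith

lemma weightedPolylog_realHarmonic_one (hy : y ∈ Set.Ico 0 1) :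
    weightedPolylog realHarmonic 1 (-y) = Real.log (1 + y) ^ 2 / 2 := by
  have hneg : ∀ t ∈ Set.Icc 0 y, |-t| < 1 := fun t ht => by
    rw [abs_neg, abs_of_nonneg ht.1]; exact ht.2.trans_lt hy.2
  have hd : ∀ t ∈ Set.Icc 0 y, HasDerivAt
      (fun t => weightedPolylog realHarmonic 1 (-t) - Real.log (1 + t) ^ 2 / 2) 0 t := by
    intro t ht
    have h1 : 0 < 1 + t := by linarith [ht.1]
    have hw := (hasDerivAt_weightedPolylog_tsum abs_realHarmonic_le 0 (hneg t ht)).comp t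
      (hasDerivAt_neg t)
    have hl : HasDerivAt (fun t => Real.log (1 + t)) (1 / (1 + t)) t := by
      simpa using ((hasDerivAt_id t).const_add 1).log (by simpa using h1.ne')
    refine (hw.sub ((hl.pow 2).div_const 2)).congr_deriv ?_
    have hg := one_sub_mul_tsum_realHarmonic (hneg t ht)
    rw [sub_neg_eq_add] at hg
    simp only [pow_zero, div_one]
    field_simp
    linear_combination -2 * hg
  have h := eq_of_hasDerivAt_zero hy.1
    (fun t ht => (hd t ht).continuousAt.continuousWithinAt)
    fun t ht => hd t ⟨ht.1.le, ht.2.le⟩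
  simp [weightedPolylog_zero_right] at h
  linarith

lemma weightedPolylog_realHarmonic_two (hy : y ∈ Set.Ico 0 1) :
    weightedPolylog realHarmonic 2 (-y) = Li 3 (y / (1 + y)) + Li 3 (-y)
      - Real.log (1 + y) * Li 2 (-y) - Real.log (1 + y) ^ 3 / 6 := by
  have hsub : Set.Icc 0 y ⊆ Set.Icc 0 1 := Set.Icc_subset_Icc_right hy.2.le
  have hc : ContinuousOn (fun t => weightedPolylog realHarmonic 2 (-t)) (Set.Icc 0 y) :=
    fun t ht => ((hasDerivAt_weightedPolylog_tsum abs_realHarmonic_le 1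
      (by rw [abs_neg, abs_of_nonneg ht.1]; exact ht.2.trans_lt hy.2)).comp t
        (hasDerivAt_neg t)).continuousAt.continuousWithinAt
  have h := eq_of_hasDerivAt_zero
    (f := fun t => weightedPolylog realHarmonic 2 (-t) - (Li 3 (t / (1 + t)) + Li 3 (-t)
      - Real.log (1 + t) * Li 2 (-t) - Real.log (1 + t) ^ 3 / 6)) hy.1
    (hc.sub ((((continuousOn_Li_div_one_add (by norm_num)).add
      (continuousOn_Li_neg (by norm_num))).sub
      (continuousOn_log_one_add.mul (continuousOn_Li_neg le_rfl))).sub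
      ((continuousOn_log_one_add.pow 3).div_const 6) |>.mono hsub)) fun t ht => by
      have ht' : t ∈ Set.Ioo 0 1 := ⟨ht.1, ht.2.trans hy.2⟩
      have h1 : 0 < 1 + t := by linarith [ht.1]
      have h0 := ht.1
      have hL := hasDerivAt_log_one_add ht.1
      refine ((hasDerivAt_weightedPolylog_neg abs_realHarmonic_le 1 ht').sub
        ((((hasDerivAt_Li_div_one_add 2 ht.1).add (hasDerivAt_Li_neg 2 ht')).sub
        (hL.mul (hasDerivAt_Li_neg 1 ht'))).sub ((hL.pow 3).div_const 6))).congr_deriv ?_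
      rw [Li_one_neg ht', Li_two_landen ⟨ht.1.le, ht'.2.le⟩,
        weightedPolylog_realHarmonic_one ⟨ht.1.le, ht'.2⟩]
      field_simp
      ring
  simp [Li_zero_right, weightedPolylog_zero_right] at h
  linarith

end Interval

lemma Li_two_half : Li 2 (1 / 2) = Li 2 1 / 2 - Real.log 2 ^ 2 / 2 := by
  have h := Li_two_landen (y := 1) (by simp)
  rw [Li_neg_one le_rfl] at h
  norm_num at h ⊢
  linarith

lemma Li_three_half :
    Li 3 (1 / 2) = 7 / 8 * Li 3 1 - Li 2 1 * Real.log 2 / 2 + Real.log 2 ^ 3 / 6 := by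
  have h := eq_of_hasDerivAt_zero (a := 0) (b := 1)
    (f := fun t => Li 3 (t / (1 + t)) + Li 3 (-t) - Real.log (1 + t) * Li 2 (-t)
      + Real.log (1 + t) ^ 3 / 6
      - Real.log t * Real.log (1 + t) * Real.log (1 + t) / 2
      + Li 2 (1 / (1 + t)) * Real.log (1 + t) + Li 3 (1 / (1 + t))) zero_le_one
    (((((((continuousOn_Li_div_one_add (by norm_num)).add
      (continuousOn_Li_neg (by norm_num))).sub
      (continuousOn_log_one_add.mul (continuousOn_Li_neg le_rfl))).add
      ((continuousOn_log_one_add.pow 3).div_const 6)).sub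
      ((continuousOn_log_mul_log_one_add.mul continuousOn_log_one_add).div_const 2)).add
      ((continuousOn_Li_inv_one_add le_rfl).mul continuousOn_log_one_add)).add
      (continuousOn_Li_inv_one_add (by norm_num))) fun t ht => by
      have h1 : 0 < 1 + t := by linarith [ht.1]
      have h0 := ht.1
      have hL := hasDerivAt_log_one_add ht.1
      refine ((((((((hasDerivAt_Li_div_one_add 2 h0).add (hasDerivAt_Li_neg 2 ht)).sub
        (hL.mul (hasDerivAt_Li_neg 1 ht))).add ((hL.pow 3).div_const 6)).sub
        ((((Real.hasDerivAt_log h0.ne').mul hL).mul hL).div_const 2)).add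
        ((hasDerivAt_Li_inv_one_add 1 h0).mul hL)).add
        (hasDerivAt_Li_inv_one_add 2 h0))).congr_deriv ?_
      rw [Li_one_neg ht, Li_two_landen ⟨h0.le, ht.2.le⟩, Li_one_inv_one_add h0]
      simp only [Pi.mul_apply]
      field_simp
      ring
  have h2 := Li_two_half
  have e2 := Li_neg_one (k := 2) le_rfl
  have e3 := Li_neg_one (k := 3) (by norm_num)
  norm_num [Li_zero_right] at h h2 e2 e3 ⊢
  rw [h2, e2, e3] at h
  linarith

lemma weightedPolylog_realHarmonic_three_neg_one :
    weightedPolylog realHarmonic 3 (-1) = 2 * Li 4 (1 / 2) - 15 / 8 * Li 4 1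
      + 7 / 4 * Li 3 1 * Real.log 2 - Li 2 1 * Real.log 2 ^ 2 / 2 + Real.log 2 ^ 4 / 12 := by
  have hF : ContinuousOn (fun t => weightedPolylog realHarmonic 3 (-t)) (Set.Icc 0 1) := by
    refine (continuousOn_weightedPolylog ?_).comp (by fun_prop)
      fun t ht => ⟨by linarith [ht.2], by linarith [ht.1]⟩
    refine Summable.of_nonneg_of_le (fun m => by positivity) (fun m => ?_)
      (summable_one_div_succ_pow le_rfl)
    rw [div_le_div_iff₀ (by positivity) (by positivity), one_mul, pow_succ' _ 2]
    exact mul_le_mul_of_nonneg_right (abs_realHarmonic_le m) (by positivity)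
  have cL := continuousOn_log_one_add
  have h := eq_of_hasDerivAt_zero (a := 0) (b := 1)
    (f := fun t => weightedPolylog realHarmonic 3 (-t) - Li 4 (t / (1 + t)) - Li 4 (-t)
      - Real.log (1 + t) * Li 3 (t / (1 + t)) + Real.log (1 + t) ^ 2 * Li 2 (-t) / 2
      + Real.log t * Real.log (1 + t) * Real.log (1 + t) ^ 2 / 6
      - Li 4 (1 / (1 + t)) - Real.log (1 + t) * Li 3 (1 / (1 + t))
      - Real.log (1 + t) ^ 2 * Li 2 (1 / (1 + t)) / 2) zero_le_one
    ((((((((hF.sub (continuousOn_Li_div_one_add (by norm_num))).sub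
      (continuousOn_Li_neg (by norm_num))).sub
      (cL.mul (continuousOn_Li_div_one_add (by norm_num)))).add
      (((cL.pow 2).mul (continuousOn_Li_neg le_rfl)).div_const 2)).add
      ((continuousOn_log_mul_log_one_add.mul (cL.pow 2)).div_const 6)).sub
      (continuousOn_Li_inv_one_add (by norm_num))).sub
      (cL.mul (continuousOn_Li_inv_one_add (by norm_num)))).sub
      (((cL.pow 2).mul (continuousOn_Li_inv_one_add le_rfl)).div_const 2)) fun t ht => by
      have h1 : 0 < 1 + t := by linarith [ht.1]
      have h0 := ht.1
      have hL := hasDerivAt_log_one_add ht.1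
      refine (((((((((hasDerivAt_weightedPolylog_neg abs_realHarmonic_le 2 ht).sub
        (hasDerivAt_Li_div_one_add 3 h0)).sub (hasDerivAt_Li_neg 3 ht)).sub
        (hL.mul (hasDerivAt_Li_div_one_add 2 h0))).add
        (((hL.pow 2).mul (hasDerivAt_Li_neg 1 ht)).div_const 2)).add
        ((((Real.hasDerivAt_log h0.ne').mul hL).mul (hL.pow 2)).div_const 6)).sub
        (hasDerivAt_Li_inv_one_add 3 h0)).sub
        (hL.mul (hasDerivAt_Li_inv_one_add 2 h0))).sub
        (((hL.pow 2).mul (hasDerivAt_Li_inv_one_add 1 h0)).div_const 2)).congr_deriv ?_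
      rw [weightedPolylog_realHarmonic_two ⟨h0.le, ht.2⟩, Li_one_neg ht,
        Li_two_landen ⟨h0.le, ht.2.le⟩, Li_one_inv_one_add h0]
      simp only [Pi.mul_apply, Pi.pow_apply]
      field_simp
      ring
  have h2 := Li_two_half
  have h3 := Li_three_half
  have e2 := Li_neg_one (k := 2) le_rfl
  have e4 := Li_neg_one (k := 4) (by norm_num)
  norm_num [Li_zero_right, weightedPolylog_zero_right] at h h2 h3 e2 e4 ⊢
  rw [h2, h3, e2, e4] at h
  linarith

lemma zetaMinus_one_three :
    zetaMinus ![1, 3] = -weightedPolylog realHarmonic 3 (-1) := by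
  let f : ℕ → ℕ → ℝ := fun n m =>
    if m < n then (-1 : ℝ) ^ n * (1 / (m + 1 : ℝ) * (1 / (n + 1 : ℝ) ^ 3)) else 0
  have hrow : ∀ n m, m ∉ Finset.range n → f n m = 0 := fun n m hm => by
    simp only [Finset.mem_range] at hm
    simp [f, hm]
  have hsum : ∀ n, ∑' m, f n m = (-1 : ℝ) ^ n * (realHarmonic n / (n + 1 : ℝ) ^ 3) := fun n => by
    rw [tsum_eq_sum (hrow n), realHarmonic_eq_sum, Finset.sum_div, Finset.mul_sum]
    refine Finset.sum_congr rfl fun m hm => ?_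
    simp only [f, if_pos (Finset.mem_range.mp hm)]
    ring
  have habs : ∀ n m, |f n m| = (-1 : ℝ) ^ n * f n m := fun n m => by
    simp only [f]
    split_ifs
    · rw [← mul_assoc ((-1) ^ n) ((-1) ^ n), ← mul_pow, abs_mul, abs_of_nonneg (by positivity : (0 : ℝ) ≤
        1 / (m + 1 : ℝ) * (1 / (n + 1 : ℝ) ^ 3))]
      simp
    · simp
  have hs : Summable (Function.uncurry f) := by
    rw [← summable_abs_iff, summable_prod_of_nonneg fun p => abs_nonneg _]
    refine ⟨fun n => summable_of_ne_finset_zero (s := Finset.range n) fun m hm => by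
      simp [hrow n m hm], ?_⟩
    refine Summable.of_nonneg_of_le (fun n => tsum_nonneg fun m => abs_nonneg _) (fun n => ?_)
      (summable_one_div_succ_pow le_rfl)
    simp only [Function.uncurry_apply_pair, habs]
    rw [tsum_mul_left, hsum, ← mul_assoc, ← mul_pow]
    rw [neg_one_mul, neg_neg, one_pow, one_mul,
      div_le_div_iff₀ (by positivity) (by positivity), one_mul, pow_succ' _ 2]
    exact mul_le_mul_of_nonneg_right ((le_abs_self _).trans (abs_realHarmonic_le n))
      (by positivity)
  have key : zetaMinus ![1, 3] = ∑' p : ℕ × ℕ, Function.uncurry f p := by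
    rw [zetaMinus, ← ((finTwoArrowEquiv ℕ).trans (Equiv.prodComm ℕ ℕ)).tsum_eq]
    refine tsum_congr fun m => ?_
    have : StrictMono m ↔ m 0 < m 1 := by
      rw [Fin.strictMono_iff_lt_succ]; simp
    simp [f, this, Fin.prod_univ_two, mul_comm]
  rw [key, hs.tsum_prod' fun n => summable_of_ne_finset_zero (s := Finset.range n) (hrow n),
    weightedPolylog, ← tsum_neg]
  refine tsum_congr fun n => ?_
  simp only [Function.uncurry_apply_pair]
  rw [hsum]
  ring

theorem stmt1 :
    (zetaMinus (![1, 3]) : ℂ)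
      = -2 * (Li 4 (1/2) : ℝ) - ((Real.log 2) ^ 4 : ℝ) / 12
        + (15 / 8) * riemannZeta 4
        - (7 / 4) * riemannZeta 3 * (Real.log 2 : ℝ)
        + (1 / 2) * riemannZeta 2 * ((Real.log 2) ^ 2 : ℝ) := by
  have h2 : riemannZeta 2 = (Li 2 1 : ℝ) := by exact_mod_cast riemannZeta_eq_Li (k := 2) le_rfl
  have h3 : riemannZeta 3 = (Li 3 1 : ℝ) := by
    exact_mod_cast riemannZeta_eq_Li (k := 3) (by norm_num)
  have h4 : riemannZeta 4 = (Li 4 1 : ℝ) := by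
    exact_mod_cast riemannZeta_eq_Li (k := 4) (by norm_num)
  rw [h2, h3, h4, zetaMinus_one_three, weightedPolylog_realHarmonic_three_neg_one]
  push_cast
  ring
end

section
/- For every integer r ≥ 0, Σ_{i=0}^{r} (δ_{i0} + 1) ζ₋*({1}^{r-i}, 2+i) = (r+1) ζ(r+2), where δ_{i0} is Kronecker's delta. -/
open scoped BigOperators

/-- Alternating multiple zeta-star value ζ₋*, encoded with mᵢ = m i + 1. -/
noncomputable def zetaStarMinus {n : ℕ} (k : Fin (n + 1) → ℕ) : ℝ :=
  ∑' m : Fin (n + 1) → ℕ, if Monotone m then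
    (-1 : ℝ) ^ (m (Fin.last n)) * ∏ i, (1 : ℝ) / ((m i + 1 : ℝ) ^ (k i)) else 0

open Filter Topology Finset PowerSeries

section Field

variable {K : Type*} [Field K]

/-- The weight `∏_{i<m} (N - i) / (N + 1 + i - x)`. -/
def wellPoisedWeight (x : K) (N m : ℕ) : K :=
  ∏ i ∈ range m, ((N : K) - i) / ((N : K) + 1 + i - x)

/-- The product `∏_{l=1}^m l / (l - x)`. -/
def risingRatio (x : K) (m : ℕ) : K :=
  ∏ l ∈ range m, ((l : K) + 1) / ((l : K) + 1 - x)

theorem wellPoisedWeight_succ_left {x : K} (hx : ∀ n : ℕ, (n : K) + 1 - x ≠ 0) (N m : ℕ) :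
    wellPoisedWeight x N m * ((N + 1) * (N + 1 - x)) =
      wellPoisedWeight x (N + 1) m * ((N + 1 - m) * (N + 1 + m - x)) := by
  induction m with
  | zero => simp [wellPoisedWeight]
  | succ m ih =>
    have h1 : (N : K) + 1 + m - x ≠ 0 := by
      have := hx (N + m); push_cast at this; convert this using 1; ring
    have h2 : (N : K) + 1 + 1 + m - x ≠ 0 := by
      have := hx (N + 1 + m); push_cast at this; convert this using 1; ring
    simp only [wellPoisedWeight, prod_range_succ] at ih ⊢
    push_cast at ih ⊢
    rw [mul_right_comm, ih]
    field_simp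
    ring

theorem sum_wellPoised {x : K} [CharZero K] (hx : ∀ n : ℕ, (n : K) + 1 - x ≠ 0) (N : ℕ) :
    ∑ m ∈ range N, (-1) ^ m * (1 / ((m : K) + 1) ^ 2) * ((1 + (m + 1) / (m + 1 - x)) *
      (risingRatio x (m + 1) * wellPoisedWeight x N (m + 1))) =
    ∑ n ∈ range N, (1 / ((n : K) + 1 - x)) ^ 2 := by
  induction N with
  | zero => simp
  | succ N ih =>
    let G : ℕ → K := fun m => (-1) ^ (m + 1) * risingRatio x m * wellPoisedWeight x (N + 1) m *
      (N + 1 - m) / ((N + 1) * (N + 1 - x) ^ 2)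
    have hN : (N : K) + 1 ≠ 0 := Nat.cast_add_one_ne_zero N
    have hNx := hx N
    have step : ∀ m : ℕ, (-1) ^ m * (1 / ((m : K) + 1) ^ 2) * ((1 + (m + 1) / (m + 1 - x)) *
          (risingRatio x (m + 1) * wellPoisedWeight x (N + 1) (m + 1))) =
        (-1) ^ m * (1 / ((m : K) + 1) ^ 2) * ((1 + (m + 1) / (m + 1 - x)) *
          (risingRatio x (m + 1) * wellPoisedWeight x N (m + 1))) + (G (m + 1) - G m) := by
      intro m
      have hm : (m : K) + 1 ≠ 0 := Nat.cast_add_one_ne_zero m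
      have hmx := hx m
      have h2 : (N : K) + 1 + 1 + m - x ≠ 0 := by
        have := hx (N + 1 + m); push_cast at this; convert this using 1; ring
      have hw : wellPoisedWeight x N (m + 1) = wellPoisedWeight x (N + 1) (m + 1) *
          ((N - m) * (N + 1 + 1 + m - x)) / ((N + 1) * (N + 1 - x)) := by
        rw [eq_div_iff (mul_ne_zero hN hNx), wellPoisedWeight_succ_left hx]
        push_cast
        ring
      have hs : wellPoisedWeight x (N + 1) (m + 1) =
          wellPoisedWeight x (N + 1) m * ((N + 1 - m) / (N + 1 + 1 + m - x)) := by
        rw [wellPoisedWeight, prod_range_succ, ← wellPoisedWeight]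
        push_cast
        rfl
      have hr : risingRatio x (m + 1) = risingRatio x m * ((m + 1) / (m + 1 - x)) := by
        rw [risingRatio, prod_range_succ, ← risingRatio]
      simp only [G]
      rw [hw, hs, hr]
      push_cast
      field_simp
      ring
    rw [sum_congr rfl (fun m _ => step m), sum_add_distrib, sum_range_sub, sum_range_succ, ih,
      sum_range_succ _ N]
    have h0 : wellPoisedWeight x N (N + 1) = 0 := by
      simp [wellPoisedWeight, prod_range_succ]
    simp only [h0, G]
    simp [risingRatio, wellPoisedWeight]
    field_simp
    ring

end Field

/-- The geometric series `1 / (1 - c X)`. -/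
noncomputable def geomSeries (c : ℝ) : ℝ⟦X⟧ := PowerSeries.mk fun n => c ^ n

/-- The generating series `∏_{l=1}^m (1 - X / l)⁻¹` of the complete homogeneous symmetric
functions of `1, 1/2, …, 1/m`. -/
noncomputable def homogSeries (m : ℕ) : ℝ⟦X⟧ := ∏ l ∈ range m, geomSeries (1 / (l + 1))

/-- The expansion of `wellPoisedWeight` as a power series in `x`. -/
noncomputable def weightSeries (N m : ℕ) : ℝ⟦X⟧ :=
  ∏ i ∈ range m, (C (((N : ℝ) - i) / (N + 1 + i)) * geomSeries (1 / (N + 1 + i)))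

theorem geomSeries_mul (c : ℝ) : geomSeries c * (1 - C c * X) = 1 := by
  ext n
  cases n with
  | zero => simp [geomSeries]
  | succ n =>
    rw [mul_sub, mul_one, mul_comm (C c) X, ← mul_assoc, map_sub, coeff_mul_C, coeff_succ_mul_X]
    simp [geomSeries, coeff_one, pow_succ]

theorem geomSeries_mul_natCast_sub (n : ℕ) :
    geomSeries (1 / (n + 1)) * ((n : ℝ⟦X⟧) + 1 - X) = (n : ℝ⟦X⟧) + 1 := by
  have h := geomSeries_mul (1 / (n + 1))
  have hC : (C (1 / ((n : ℝ) + 1)) : ℝ⟦X⟧) * ((n : ℝ⟦X⟧) + 1) = 1 := by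
    have : ((n : ℝ⟦X⟧) + 1) = C ((n : ℝ) + 1) := by simp
    rw [this, ← map_mul, one_div_mul_cancel (Nat.cast_add_one_ne_zero n), map_one]
  linear_combination ((n : ℝ⟦X⟧) + 1) * h + geomSeries (1 / (n + 1)) * X * hC

theorem natCast_add_one_sub_X_ne_zero (n : ℕ) : (n : ℝ⟦X⟧) + 1 - X ≠ 0 := by
  intro h
  have h0 := congrArg constantCoeff h
  simp only [map_sub, map_add, map_natCast, map_one, constantCoeff_X, sub_zero, map_zero] at h0
  exact Nat.cast_add_one_ne_zero n h0

theorem sum_homogSeries_mul_weightSeries (N : ℕ) :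
    ∑ m ∈ range N, C ((-1) ^ m * (1 / ((m : ℝ) + 1) ^ 2)) * ((1 + geomSeries (1 / (m + 1))) *
      (homogSeries (m + 1) * weightSeries N (m + 1))) =
    ∑ n ∈ range N, C ((1 / ((n : ℝ) + 1)) ^ 2) * geomSeries (1 / (n + 1)) ^ 2 := by
  obtain ⟨K, _, φ, hφ⟩ : ∃ (K : Type) (_ : Field K) (φ : ℝ⟦X⟧ →+* K), Function.Injective φ :=
    ⟨FractionRing ℝ⟦X⟧, inferInstance, algebraMap _ _, IsFractionRing.injective _ _⟩
  have : CharZero K := charZero_of_injective_ringHom (φ.comp C).injective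
  apply hφ
  have hx : ∀ n : ℕ, (n : K) + 1 - φ X ≠ 0 := by
    intro n h
    apply natCast_add_one_sub_X_ne_zero n
    apply hφ
    simpa using h
  have hg : ∀ n : ℕ, φ (geomSeries (1 / (n + 1))) = (n + 1) / (n + 1 - φ X) := by
    intro n
    rw [eq_div_iff (hx n)]
    simpa using congrArg φ (geomSeries_mul_natCast_sub n)
  let ψ : ℝ →+* K := φ.comp C
  have hψ : ∀ c, φ (C c) = ψ c := fun _ => rfl
  have hW : ∀ m, φ (weightSeries N m) = wellPoisedWeight (φ X) N m := by
    intro m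
    rw [weightSeries, wellPoisedWeight, map_prod]
    refine prod_congr rfl fun i _ => ?_
    have h1 : ((N : K) + i + 1) ≠ 0 := by
      simpa using (Nat.cast_add_one_ne_zero (N + i) : ((N + i : ℕ) : K) + 1 ≠ 0)
    have h := hg (N + i)
    have h2 := hx (N + i)
    push_cast at h h2
    rw [map_mul, hψ, add_right_comm (N : ℝ), h, add_right_comm (N : K)]
    simp only [map_div₀, map_sub, map_add, map_natCast, map_one]
    field_simp
    ring
  have hP : ∀ m, φ (homogSeries m) = risingRatio (φ X) m := by
    intro m
    rw [homogSeries, risingRatio, map_prod]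
    exact prod_congr rfl fun i _ => hg i
  have key := sum_wellPoised hx N
  simp only [map_sum, map_mul, map_add, map_pow, hg, hW, hP, hψ, map_one, map_neg, map_div₀,
    map_natCast]
  convert key using 2 with n hn n hn
  have h1 : (n : K) + 1 ≠ 0 := Nat.cast_add_one_ne_zero n
  have := hx n
  field_simp

/-- `f` is dominated by the geometric series with ratio `b`. -/
def GeomBounded (f : ℝ⟦X⟧) (b : ℝ) : Prop := ∀ n, |coeff n f| ≤ b ^ n

theorem geomBounded_geomSeries {c : ℝ} (hc : 0 ≤ c) : GeomBounded (geomSeries c) c := by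
  intro n
  simp [geomSeries, abs_of_nonneg hc]

theorem geomBounded_one : GeomBounded 1 0 := by
  intro n
  rcases eq_or_ne n 0 with rfl | hn
  · simp
  · simp [coeff_one, hn]

theorem GeomBounded.mono {f : ℝ⟦X⟧} {b c : ℝ} (h : GeomBounded f b) (hb : 0 ≤ b) (hbc : b ≤ c) :
    GeomBounded f c :=
  fun n => (h n).trans (pow_le_pow_left₀ hb hbc n)

theorem GeomBounded.C_mul {f : ℝ⟦X⟧} {b a : ℝ} (h : GeomBounded f b) (ha : |a| ≤ 1) :
    GeomBounded (C a * f) b := by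
  intro n
  rw [coeff_C_mul, abs_mul]
  exact (mul_le_of_le_one_left (abs_nonneg _) ha).trans (h n)

theorem GeomBounded.mul {f g : ℝ⟦X⟧} {b c : ℝ} (hf : GeomBounded f b) (hg : GeomBounded g c)
    (hb : 0 ≤ b) (hc : 0 ≤ c) : GeomBounded (f * g) (b + c) := by
  intro n
  rw [coeff_mul, (Commute.all b c).add_pow']
  refine (abs_sum_le_sum_abs _ _).trans (sum_le_sum fun p hp => ?_)
  rw [abs_mul, nsmul_eq_mul]
  refine (mul_le_mul (hf _) (hg _) (abs_nonneg _) (by positivity)).trans ?_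
  refine le_mul_of_one_le_left (by positivity) ?_
  have : p.1 ≤ n := by
    have := mem_antidiagonal.1 hp
    omega
  exact_mod_cast Nat.choose_pos this

theorem geomBounded_prod {f : ℕ → ℝ⟦X⟧} {b : ℕ → ℝ} (hb : ∀ i, 0 ≤ b i)
    (h : ∀ i, GeomBounded (f i) (b i)) (m : ℕ) :
    GeomBounded (∏ i ∈ range m, f i) (∑ i ∈ range m, b i) := by
  induction m with
  | zero => simpa using geomBounded_one
  | succ m ih =>
    rw [prod_range_succ, sum_range_succ]
    exact ih.mul (h m) (sum_nonneg fun i _ => hb i) (hb m)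

/-- The harmonic number `1 + 1/2 + ⋯ + 1/m` as a real number. -/
noncomputable def harmonicSum (m : ℕ) : ℝ := ∑ l ∈ range m, 1 / ((l : ℝ) + 1)

theorem harmonicSum_nonneg (m : ℕ) : 0 ≤ harmonicSum m :=
  sum_nonneg fun i _ => by positivity

theorem geomBounded_homogSeries (m : ℕ) : GeomBounded (homogSeries m) (harmonicSum m) :=
  geomBounded_prod (fun i => by positivity)
    (fun i => geomBounded_geomSeries (c := 1 / ((i : ℝ) + 1)) (by positivity)) m

theorem geomBounded_weightSeries (N m : ℕ) : GeomBounded (weightSeries N m) (harmonicSum m) := by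
  refine geomBounded_prod (fun i => by positivity) (fun i => ?_) m
  refine GeomBounded.C_mul ?_ ?_
  · refine (geomBounded_geomSeries (by positivity)).mono (by positivity) ?_
    have : (0 : ℝ) ≤ N := by positivity
    exact one_div_le_one_div_of_le (by positivity) (by linarith)
  · have h1 : (0 : ℝ) ≤ N := by positivity
    have h2 : (0 : ℝ) ≤ i := by positivity
    rw [abs_div, abs_of_pos (by positivity : (0 : ℝ) < N + 1 + i), div_le_one (by positivity),
      abs_le]
    constructor <;> linarith

theorem summable_harmonicSum_pow (r : ℕ) :
    Summable fun m : ℕ => 1 / ((m : ℝ) + 1) ^ 2 * (1 + 2 * harmonicSum (m + 1)) ^ r := by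
  have hle : ∀ n : ℕ, harmonicSum n ≤ 1 + Real.log n := by
    intro n
    have h := harmonic_le_one_add_log n
    have : ((harmonic n : ℚ) : ℝ) = harmonicSum n := by
      simp [harmonic, harmonicSum]
    rwa [this] at h
  have hO : (fun n : ℕ => 1 / (n : ℝ) ^ 2 * (1 + 2 * harmonicSum n) ^ r) =O[atTop]
      fun n : ℕ => 1 / (n : ℝ) ^ (3 / 2 : ℝ) := by
    have h1 : (fun x : ℝ => 3 + 2 * Real.log x) =O[atTop] Real.log :=
      (Real.isLittleO_const_log_atTop.isBigO).add ((Asymptotics.isBigO_refl _ _).const_mul_left 2)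
    have h2 : (fun x : ℝ => (3 + 2 * Real.log x) ^ r) =O[atTop] fun x => x ^ (1 / 2 : ℝ) := by
      refine (h1.pow r).trans ?_
      have := (isLittleO_log_rpow_rpow_atTop (s := 1 / 2) (r : ℝ) (by norm_num)).isBigO
      simpa only [Real.rpow_natCast] using this
    have h3 := h2.comp_tendsto (tendsto_natCast_atTop_atTop (R := ℝ))
    have h4 : (fun n : ℕ => (1 + 2 * harmonicSum n) ^ r) =O[atTop]
        fun n : ℕ => (n : ℝ) ^ (1 / 2 : ℝ) := by
      refine Asymptotics.IsBigO.trans (Asymptotics.IsBigO.of_bound 1 ?_) h3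
      refine Eventually.of_forall fun n => ?_
      have h0 := harmonicSum_nonneg n
      rw [one_mul, Real.norm_of_nonneg (by positivity)]
      refine le_trans ?_ (le_abs_self _)
      refine pow_le_pow_left₀ (by positivity) ?_ r
      have := hle n
      linarith
    have h5 := (Asymptotics.isBigO_refl (fun n : ℕ => 1 / (n : ℝ) ^ 2) atTop).mul h4
    refine h5.congr' EventuallyEq.rfl ?_
    filter_upwards [eventually_gt_atTop 0] with n hn
    have hn' : (0 : ℝ) < n := by exact_mod_cast hn
    rw [one_div_mul_eq_div, div_eq_div_iff (by positivity) (by positivity), one_mul,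
      ← Real.rpow_add hn', ← Real.rpow_natCast]
    norm_num
  have hs := summable_of_isBigO_nat (Real.summable_one_div_nat_rpow.2 (by norm_num)) hO
  simpa using (summable_nat_add_iff 1).2 hs

theorem abs_coeff_summand_le (N m r : ℕ) :
    |coeff r (C ((-1) ^ m * (1 / ((m : ℝ) + 1) ^ 2)) * ((1 + geomSeries (1 / (m + 1))) *
      (homogSeries (m + 1) * weightSeries N (m + 1))))| ≤
    2 * (1 / ((m : ℝ) + 1) ^ 2 * (1 + 2 * harmonicSum (m + 1)) ^ r) := by
  have hH := harmonicSum_nonneg (m + 1)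
  have h1 := (geomBounded_homogSeries (m + 1)).mul (geomBounded_weightSeries N (m + 1)) hH hH
  have hg : GeomBounded (geomSeries (1 / ((m : ℝ) + 1))) 1 :=
    (geomBounded_geomSeries (by positivity)).mono (by positivity)
      (div_le_one_of_le₀ (by linarith [Nat.cast_nonneg (α := ℝ) m]) (by positivity))
  have h2 := hg.mul h1 zero_le_one (by positivity)
  have h3 := h1.mono (by positivity)
    (show harmonicSum (m + 1) + harmonicSum (m + 1) ≤
      1 + (harmonicSum (m + 1) + harmonicSum (m + 1)) by linarith)
  rw [coeff_C_mul, abs_mul, abs_mul, abs_pow, abs_neg, abs_one, one_pow, one_mul,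
    abs_of_pos (by positivity : (0 : ℝ) < 1 / ((m : ℝ) + 1) ^ 2), add_mul, one_mul, map_add,
    mul_left_comm 2, two_mul (_ ^ r), two_mul (harmonicSum _)]
  refine mul_le_mul_of_nonneg_left ?_ (by positivity)
  exact (abs_add_le _ _).trans (add_le_add (h3 r) (h2 r))

theorem tendsto_coeff_mul {f g : ℕ → ℝ⟦X⟧} {f₀ g₀ : ℝ⟦X⟧}
    (hf : ∀ n, Tendsto (fun N => coeff n (f N)) atTop (𝓝 (coeff n f₀)))
    (hg : ∀ n, Tendsto (fun N => coeff n (g N)) atTop (𝓝 (coeff n g₀))) (n : ℕ) :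
    Tendsto (fun N => coeff n (f N * g N)) atTop (𝓝 (coeff n (f₀ * g₀))) := by
  simp only [coeff_mul]
  exact tendsto_finsetSum _ fun p _ => (hf _).mul (hg _)

theorem tendsto_coeff_weightSeries (m n : ℕ) :
    Tendsto (fun N => coeff n (weightSeries N m)) atTop (𝓝 (coeff n (1 : ℝ⟦X⟧))) := by
  induction m generalizing n with
  | zero => simp [weightSeries]
  | succ m ih =>
    simp only [weightSeries, prod_range_succ]
    rw [← mul_one (1 : ℝ⟦X⟧)]
    refine tendsto_coeff_mul ih (fun n => ?_) n
    simp only [coeff_C_mul, geomSeries, coeff_mk]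
    have hinv : Tendsto (fun N : ℕ => 1 / ((N : ℝ) + 1 + m)) atTop (𝓝 0) := by
      have := (tendsto_add_atTop_iff_nat (m + 1)).2 (tendsto_one_div_atTop_nhds_zero_nat (𝕜 := ℝ))
      refine this.congr fun N => ?_
      push_cast
      ring_nf
    have hone : Tendsto (fun N : ℕ => ((N : ℝ) - m) / (N + 1 + m)) atTop (𝓝 1) := by
      have := (hinv.const_mul (2 * (m : ℝ) + 1)).const_sub 1
      rw [mul_zero, sub_zero] at this
      refine this.congr fun N => ?_
      have : (N : ℝ) + 1 + m ≠ 0 := by positivity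
      field_simp
      ring
    have := hone.mul (hinv.pow n)
    rcases eq_or_ne n 0 with rfl | hn
    · simpa using this
    · simpa [coeff_one, hn] using this

theorem coeff_geomSeries_sq (c : ℝ) (r : ℕ) :
    coeff r (geomSeries c ^ 2) = (r + 1) * c ^ r := by
  rw [sq, coeff_mul]
  simp only [geomSeries, coeff_mk, ← pow_add]
  rw [sum_congr rfl (fun p hp => by rw [mem_antidiagonal.1 hp])]
  simp

theorem tsum_coeff_homogSeries (r : ℕ) :
    ∑' m : ℕ, (-1) ^ m * (1 / ((m : ℝ) + 1) ^ 2) *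
        coeff r ((1 + geomSeries (1 / (m + 1))) * homogSeries (m + 1)) =
      (r + 1) * ∑' n : ℕ, 1 / ((n : ℝ) + 1) ^ (r + 2) := by
  have hlim : Tendsto (fun N : ℕ => ∑' m : ℕ,
      coeff r (C ((-1) ^ m * (1 / ((m : ℝ) + 1) ^ 2)) * ((1 + geomSeries (1 / (m + 1))) *
      (homogSeries (m + 1) * weightSeries N (m + 1))))) atTop
      (𝓝 (∑' m : ℕ, (-1) ^ m * (1 / ((m : ℝ) + 1) ^ 2) *
        coeff r ((1 + geomSeries (1 / (m + 1))) * homogSeries (m + 1)))) := by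
    refine tendsto_tsum_of_dominated_convergence ((summable_harmonicSum_pow r).mul_left 2)
      (fun m => ?_) (Eventually.of_forall fun N m => abs_coeff_summand_le N m r)
    simp only [coeff_C_mul]
    refine Tendsto.const_mul _ ?_
    have := tendsto_coeff_mul (f := fun _ => (1 + geomSeries (1 / ((m : ℝ) + 1))) *
      homogSeries (m + 1)) (fun n => tendsto_const_nhds) (tendsto_coeff_weightSeries (m + 1)) r
    simpa only [mul_one, mul_assoc] using this
  refine tendsto_nhds_unique hlim ?_
  have hs : Summable fun n : ℕ => 1 / ((n : ℝ) + 1) ^ (r + 2) := by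
    have := (summable_nat_add_iff 1).2
      (Real.summable_one_div_nat_pow (p := r + 2).2 (by omega))
    simpa using this
  refine (hs.hasSum.mul_left ((r : ℝ) + 1)).tendsto_sum_nat.congr fun N => ?_
  rw [tsum_eq_sum (s := range N), ← map_sum, sum_homogSeries_mul_weightSeries, map_sum]
  · refine sum_congr rfl fun n _ => ?_
    rw [coeff_C_mul, coeff_geomSeries_sq, ← one_div_pow]
    ring
  · intro m hm
    have : weightSeries N (m + 1) = 0 :=
      prod_eq_zero (i := N) (by simp at hm ⊢; omega) (by simp)
    simp [this]

theorem coeff_succ_homogSeries_succ (n m : ℕ) :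
    coeff (n + 1) (homogSeries (m + 1)) =
      coeff (n + 1) (homogSeries m) + 1 / ((m : ℝ) + 1) * coeff n (homogSeries (m + 1)) := by
  have h : homogSeries (m + 1) =
      homogSeries m + C (1 / ((m : ℝ) + 1)) * (homogSeries (m + 1) * X) := by
    rw [homogSeries, prod_range_succ, ← homogSeries]
    linear_combination homogSeries m * geomSeries_mul (1 / ((m : ℝ) + 1))
  conv_lhs => rw [h]
  rw [map_add, coeff_C_mul, coeff_succ_mul_X]

theorem coeff_succ_homogSeries (n m : ℕ) :
    coeff (n + 1) (homogSeries m) =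
      ∑ l ∈ range m, 1 / ((l : ℝ) + 1) * coeff n (homogSeries (l + 1)) := by
  induction m with
  | zero => simp [homogSeries, coeff_one]
  | succ m ih => rw [coeff_succ_homogSeries_succ, ih, sum_range_succ]

theorem coeff_homogSeries_nonneg (n m : ℕ) : 0 ≤ coeff n (homogSeries m) := by
  induction n generalizing m with
  | zero => simp [homogSeries, geomSeries, map_prod]
  | succ n ih =>
    rw [coeff_succ_homogSeries]
    exact sum_nonneg fun l _ => mul_nonneg (by positivity) (ih _)

/-- The reciprocal product of a weakly increasing tuple bounded by `M`, with entries shifted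
by one. -/
noncomputable def chainWeight (n M : ℕ) (v : Fin n → ℕ) : ℝ :=
  if Monotone v ∧ ∀ i, v i ≤ M then ∏ i, 1 / ((v i : ℝ) + 1) else 0

theorem chainWeight_nonneg (n M : ℕ) (v : Fin n → ℕ) : 0 ≤ chainWeight n M v := by
  unfold chainWeight
  split_ifs <;> positivity

theorem monotone_snoc_iff {n : ℕ} (v : Fin n → ℕ) (M : ℕ) :
    Monotone (Fin.snoc v M : Fin (n + 1) → ℕ) ↔ Monotone v ∧ ∀ i, v i ≤ M := by
  constructor
  · intro h
    refine ⟨fun i j hij => ?_, fun i => ?_⟩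
    · simpa using h (Fin.castSucc_le_castSucc_iff.2 hij)
    · simpa using h (Fin.le_last i.castSucc)
  · rintro ⟨h, hM⟩ i j hij
    induction j using Fin.lastCases with
    | last =>
      induction i using Fin.lastCases with
      | last => exact le_rfl
      | cast i => simpa using hM i
    | cast j =>
      induction i using Fin.lastCases with
      | last => exact absurd hij (not_le.2 (Fin.castSucc_lt_last j))
      | cast i => simpa using h (Fin.castSucc_le_castSucc_iff.1 hij)

/-- Summation over tuples by first summing over all entries but the last. -/
theorem hasSum_of_snoc {n : ℕ} {f : (Fin (n + 1) → ℕ) → ℝ} {c h : ℕ → ℝ}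
    (hf : ∀ M v, f (Fin.snoc v M : Fin (n + 1) → ℕ) = c M * chainWeight n M v)
    (hB : ∀ M, HasSum (chainWeight n M) (h M)) (hs : Summable fun M => |c M| * h M) :
    HasSum f (∑' M, c M * h M) := by
  have hsum : Summable fun p : ℕ × (Fin n → ℕ) => c p.1 * chainWeight n p.1 p.2 := by
    refine Summable.of_norm ?_
    rw [summable_prod_of_nonneg (fun _ => norm_nonneg _)]
    simp only [norm_mul, Real.norm_eq_abs, abs_of_nonneg (chainWeight_nonneg _ _ _)]
    refine ⟨fun M => ((hB M).mul_left _).summable, ?_⟩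
    exact hs.congr fun M => ((hB M).mul_left _).tsum_eq.symm
  have h1 := hsum.hasSum.prod_fiberwise fun M => (hB M).mul_left (c M)
  rw [h1.tsum_eq, ← (Fin.snocEquiv fun _ : Fin (n + 1) => ℕ).hasSum_iff]
  exact hsum.hasSum.congr_fun fun p => hf p.1 p.2

theorem hasSum_chainWeight (n M : ℕ) :
    HasSum (chainWeight n M) (coeff n (homogSeries (M + 1))) := by
  induction n generalizing M with
  | zero =>
    have h1 : coeff 0 (homogSeries (M + 1)) = chainWeight 0 M default := by
      simp [homogSeries, geomSeries, map_prod, chainWeight, Subsingleton.monotone]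
    rw [h1]
    exact hasSum_unique _
  | succ n ih =>
    have hc : ∀ l ∉ range (M + 1), (if l ≤ M then 1 / ((l : ℝ) + 1) else 0) = 0 := by
      intro l hl
      rw [mem_range] at hl
      exact if_neg (by omega)
    have := hasSum_of_snoc (f := chainWeight (n + 1) M)
      (c := fun l => if l ≤ M then 1 / ((l : ℝ) + 1) else 0) ?_ ih
      (summable_of_ne_finset_zero (s := range (M + 1)) fun l hl => by simp only [hc l hl]; simp)
    · rw [tsum_eq_sum (s := range (M + 1)) (fun l hl => by rw [hc l hl, zero_mul])] at this
      rw [coeff_succ_homogSeries]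
      convert this using 2 with l hl
      rw [if_pos (by rw [mem_range] at hl; omega)]
    · intro l v
      unfold chainWeight
      simp only [monotone_snoc_iff, Fin.forall_fin_succ', Fin.snoc_castSucc, Fin.snoc_last, Fin.prod_univ_castSucc]
      by_cases h : Monotone v ∧ ∀ i, v i ≤ l
      · by_cases hl : l ≤ M
        · rw [if_pos ⟨h, fun i => (h.2 i).trans hl, hl⟩, if_pos hl, if_pos h, mul_comm]
        · rw [if_neg (fun h' => hl h'.2.2), if_neg hl, zero_mul]
      · rw [if_neg (fun h' => h h'.1), if_neg h, mul_zero]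

theorem summable_coeff_homogSeries (n i : ℕ) :
    Summable fun M : ℕ => 1 / ((M : ℝ) + 1) ^ (2 + i) * coeff n (homogSeries (M + 1)) := by
  refine Summable.of_nonneg_of_le
    (fun M => mul_nonneg (by positivity) (coeff_homogSeries_nonneg _ _)) (fun M => ?_)
    (summable_harmonicSum_pow n)
  have h0 := harmonicSum_nonneg (M + 1)
  refine mul_le_mul ?_ ?_ (coeff_homogSeries_nonneg _ _) (by positivity)
  · refine one_div_le_one_div_of_le (by positivity) (pow_le_pow_right₀ ?_ (by omega))
    linarith [Nat.cast_nonneg (α := ℝ) M]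
  · refine (le_abs_self _).trans (((geomBounded_homogSeries _).mono h0 ?_) n)
    linarith

theorem summable_abs_mul_coeff_homogSeries (n i : ℕ) :
    Summable fun M : ℕ => |(-1) ^ M * (1 / ((M : ℝ) + 1) ^ (2 + i))| *
      coeff n (homogSeries (M + 1)) := by
  refine (summable_coeff_homogSeries n i).congr fun M => ?_
  rw [abs_mul, abs_pow, abs_neg, abs_one, one_pow, one_mul, abs_of_pos (by positivity)]

theorem summable_alternating_coeff_homogSeries (n i : ℕ) :
    Summable fun M : ℕ => (-1) ^ M * (1 / ((M : ℝ) + 1) ^ (2 + i)) *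
      coeff n (homogSeries (M + 1)) := by
  refine Summable.of_norm ((summable_abs_mul_coeff_homogSeries n i).congr fun M => ?_)
  rw [norm_mul, Real.norm_eq_abs, Real.norm_of_nonneg (coeff_homogSeries_nonneg _ _)]

theorem zetaStarMinus_eq_tsum (n i : ℕ) :
    zetaStarMinus (fun j : Fin (n + 1) => if j = Fin.last n then 2 + i else 1) =
      ∑' M : ℕ, (-1) ^ M * (1 / ((M : ℝ) + 1) ^ (2 + i)) * coeff n (homogSeries (M + 1)) := by
  refine (hasSum_of_snoc (fun M v => ?_) (hasSum_chainWeight n)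
    (summable_abs_mul_coeff_homogSeries n i)).tsum_eq
  unfold chainWeight
  simp only [monotone_snoc_iff, Fin.prod_univ_castSucc, Fin.snoc_castSucc, Fin.snoc_last, if_true,
    (Fin.castSucc_lt_last _).ne, if_false, pow_one, mul_ite, mul_zero]
  congr 1
  ring

theorem coeff_one_add_geomSeries_mul (c : ℝ) (f : ℝ⟦X⟧) (r : ℕ) :
    coeff r ((1 + geomSeries c) * f) =
      ∑ i ∈ range (r + 1), ((if i = 0 then 1 else 0) + 1) * (c ^ i * coeff (r - i) f) := by
  rw [coeff_mul, Nat.sum_antidiagonal_eq_sum_range_succ_mk]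
  refine sum_congr rfl fun i _ => ?_
  rcases eq_or_ne i 0 with rfl | hi
  · simp [geomSeries]
  · simp [geomSeries, coeff_one, hi]

theorem stmt4 (r : ℕ) :
    ((∑ i ∈ Finset.range (r + 1),
      ((if i = 0 then 1 else 0) + 1 : ℝ)
        * zetaStarMinus (fun j : Fin (r - i + 1) => if j = Fin.last (r - i) then 2 + i else 1) : ℝ) : ℂ)
    = (r + 1) * riemannZeta (r + 2) := by
  have hreal : ∑ i ∈ range (r + 1), ((if i = 0 then 1 else 0) + 1 : ℝ)
        * zetaStarMinus (fun j : Fin (r - i + 1) => if j = Fin.last (r - i) then 2 + i else 1) =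
      (r + 1) * ∑' n : ℕ, 1 / ((n : ℝ) + 1) ^ (r + 2) := by
    rw [← tsum_coeff_homogSeries]
    simp only [zetaStarMinus_eq_tsum, ← tsum_mul_left]
    rw [← Summable.tsum_finsetSum fun i _ =>
      (summable_alternating_coeff_homogSeries (r - i) i).mul_left _]
    refine tsum_congr fun M => ?_
    rw [coeff_one_add_geomSeries_mul, mul_sum]
    refine sum_congr rfl fun i _ => ?_
    rw [one_div_pow, pow_add]
    field_simp
  have hzeta : riemannZeta (r + 2) = ∑' n : ℕ, 1 / ((n : ℂ) + 1) ^ (r + 2) := by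
    have hre : 1 < ((r : ℂ) + 2).re := by
      simp only [Complex.add_re, Complex.natCast_re, Complex.re_ofNat]
      linarith [Nat.cast_nonneg (α := ℝ) r]
    rw [zeta_eq_tsum_one_div_nat_add_one_cpow hre]
    refine tsum_congr fun n => ?_
    rw [← Complex.cpow_natCast]
    push_cast
    rfl
  rw [hreal, hzeta]
  push_cast
  rfl
end
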